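/- Let G be a 2-connected claw-free graph on n ≥ 51 vertices. If q(G) ≥ q(EP_n), then G is Hamiltonian, unless G is isomorphic to EP_n. -/

import Mathlib

open SimpleGraph

/-- A graph is claw-free if it contains no induced `K_{1,3}`. -/
def ClawFree {V : Type*} (G : SimpleGraph V) : Prop :=
  ¬ ∃ v a b c : V, a ≠ b ∧ a ≠ c ∧ b ≠ c ∧
    G.Adj v a ∧ G.Adj v b ∧ G.Adj v c ∧ ¬ G.Adj a b ∧ ¬ G.Adj a c ∧ ¬ G.Adj b c

/-- A graph is traceable if it has a Hamilton path. -/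
def Traceable {V : Type*} (G : SimpleGraph V) : Prop := by
  classical
  exact ∃ (u v : V) (p : G.Walk u v), p.IsHamiltonian

/-- A graph is 2-connected if it has at least 3 vertices and deleting any
single vertex leaves a connected graph. -/
def TwoConnected {V : Type*} [Fintype V] [DecidableEq V] (G : SimpleGraph V) : Prop :=
  3 ≤ Fintype.card V ∧ ∀ v : V, (G.induce ({v}ᶜ : Set V)).Connected

/-- A vertex is eligible if its neighbourhood induces a connected non-complete graph. -/
def Eligible {V : Type*} (G : SimpleGraph V) (x : V) : Prop :=
  (G.induce (G.neighborSet x)).Connected ∧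
    ∃ u v : V, G.Adj x u ∧ G.Adj x v ∧ u ≠ v ∧ ¬ G.Adj u v

/-- A claw-free graph is closed if it has no eligible vertex. -/
def IsClosedGraph {V : Type*} (G : SimpleGraph V) : Prop := ∀ x : V, ¬ Eligible G x

/-- The spectral radius of a graph: the largest eigenvalue of its adjacency matrix. -/
noncomputable def adjSpectralRadius {V : Type*} [Fintype V] [DecidableEq V] (G : SimpleGraph V) : ℝ := by
  classical
  exact sSup {μ : ℝ | ∃ x : V → ℝ, x ≠ 0 ∧ (G.adjMatrix ℝ).mulVec x = μ • x}

/-- The `Q`-index of a graph: the largest eigenvalue of `Q = D + A`. -/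
noncomputable def qIndex {V : Type*} [Fintype V] [DecidableEq V] (G : SimpleGraph V) : ℝ := by
  classical
  exact sSup {μ : ℝ | ∃ x : V → ℝ, x ≠ 0 ∧
    (Matrix.diagonal (fun v => (G.degree v : ℝ)) + G.adjMatrix ℝ).mulVec x = μ • x}

/-- `EN n`: the complete graph on `{0, …, n-4}` together with pendant vertices
`n-3, n-2, n-1` attached to `0, 1, 2` respectively. -/
def ENgraph (n : ℕ) : SimpleGraph (Fin n) :=
  SimpleGraph.fromRel (fun i j =>
    (i.val < n - 3 ∧ j.val < n - 3) ∨ j.val = i.val + (n - 3))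

/-- `EP n`: a clique on `{0,…,n-7}` with `a_i = i`, a triangle `b_i = n-6+i`,
and vertices `c_i = n-3+i` with edges `a_i b_i`, `a_i c_i`, `b_i c_i` (`i = 0,1,2`). -/
def EPgraph (n : ℕ) : SimpleGraph (Fin n) :=
  SimpleGraph.fromRel (fun i j =>
    (i.val < n - 6 ∧ j.val < n - 6) ∨
    (n - 6 ≤ i.val ∧ i.val < n - 3 ∧ n - 6 ≤ j.val ∧ j.val < n - 3) ∨
    (i.val < 3 ∧ (j.val = i.val + (n - 6) ∨ j.val = i.val + (n - 3))) ∨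
    (n - 6 ≤ i.val ∧ i.val < n - 3 ∧ j.val = i.val + 3))

/-- `EP' n`: a clique on `{0,…,n-7}` with `a₁ = 0`, `b₁ = 1`, `c₁ = 2`, triangles
`a₁a₂a₃` and `b₁b₂b₃` where `a₂ = n-6`, `a₃ = n-5`, `b₂ = n-4`, `b₃ = n-3`, and
vertices `c₂ = n-2`, `c₃ = n-1` with edges `a_i b_i`, `a_i c_i`, `b_i c_i` for `i = 2,3`. -/
def EP'graph (n : ℕ) : SimpleGraph (Fin n) :=
  SimpleGraph.fromRel (fun i j =>
    (i.val < n - 6 ∧ j.val < n - 6) ∨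
    (i.val = 0 ∧ (j.val = n - 6 ∨ j.val = n - 5)) ∨
    (i.val = 1 ∧ (j.val = n - 4 ∨ j.val = n - 3)) ∨
    (i.val = n - 6 ∧ (j.val = n - 5 ∨ j.val = n - 4 ∨ j.val = n - 2)) ∨
    (i.val = n - 5 ∧ (j.val = n - 3 ∨ j.val = n - 1)) ∨
    (i.val = n - 4 ∧ (j.val = n - 3 ∨ j.val = n - 2)) ∨
    (i.val = n - 3 ∧ j.val = n - 1))

section Spectral

theorem Matrix.IsHermitian.sSup_eigenvalues_mem_and_posSemidef {ι : Type*} [Fintype ι]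
    [DecidableEq ι] [Nonempty ι] {M : Matrix ι ι ℝ} (hM : M.IsHermitian) :
    (sSup {μ : ℝ | ∃ x : ι → ℝ, x ≠ 0 ∧ M.mulVec x = μ • x} ∈
      {μ : ℝ | ∃ x : ι → ℝ, x ≠ 0 ∧ M.mulVec x = μ • x}) ∧
    (sSup {μ : ℝ | ∃ x : ι → ℝ, x ≠ 0 ∧ M.mulVec x = μ • x} • (1 : Matrix ι ι ℝ) - M).PosSemidef := by
  set s := {μ : ℝ | ∃ x : ι → ℝ, x ≠ 0 ∧ M.mulVec x = μ • x} with hs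
  have hfin : s.Finite := by
    refine (Module.End.finite_hasEigenvalue (Matrix.toLin' M)).subset ?_
    rintro μ ⟨x, hx, h⟩
    exact Module.End.hasEigenvalue_of_hasEigenvector
      ⟨Module.End.mem_eigenspace_iff.2 (by simpa using h), hx⟩
  have hne : s.Nonempty := by
    obtain ⟨i⟩ := ‹Nonempty ι›
    refine ⟨hM.eigenvalues i, (hM.eigenvectorBasis i).ofLp, ?_, hM.mulVec_eigenvectorBasis i⟩
    simpa using hM.eigenvectorBasis.orthonormal.ne_zero i
  refine ⟨hne.csSup_mem hfin, ?_⟩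
  set q := sSup s
  have hN : (q • (1 : Matrix ι ι ℝ) - M).IsHermitian := by
    refine Matrix.IsHermitian.sub ?_ hM
    simp [Matrix.IsHermitian]
  rw [hN.posSemidef_iff_eigenvalues_nonneg]
  intro i
  have h := hN.mulVec_eigenvectorBasis i
  have hx : (hN.eigenvectorBasis i).ofLp ≠ 0 := by
    simpa using hN.eigenvectorBasis.orthonormal.ne_zero i
  have : q - hN.eigenvalues i ∈ s := by
    refine ⟨_, hx, ?_⟩
    rw [Matrix.sub_mulVec, Matrix.smul_mulVec, Matrix.one_mulVec] at h
    rw [sub_smul, ← h]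
    simp
  have := le_csSup hfin.bddAbove this
  simp only [Pi.zero_apply]
  linarith

open Classical in
/-- The action of the signless Laplacian on a vector. -/
noncomputable def signlessMul {V : Type*} [Fintype V] (G : SimpleGraph V) (x : V → ℝ) (v : V) : ℝ :=
  ∑ u, if G.Adj v u then x v + x u else 0

variable {V : Type*} [Fintype V] [DecidableEq V]

theorem signlessMul_spec [Nonempty V] (G : SimpleGraph V) :
    (∃ x : V → ℝ, x ≠ 0 ∧ ∀ v, signlessMul G x v = qIndex G * x v) ∧
    (∀ x : V → ℝ, ∑ v, x v * signlessMul G x v ≤ qIndex G * ∑ v, x v ^ 2) ∧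
    (∀ x : V → ℝ, ∑ v, x v * signlessMul G x v = qIndex G * ∑ v, x v ^ 2 →
      ∀ v, signlessMul G x v = qIndex G * x v) := by
  classical
  let M : Matrix V V ℝ := Matrix.diagonal (fun v => (G.degree v : ℝ)) + G.adjMatrix ℝ
  have hmul : ∀ x, M.mulVec x = signlessMul G x := by
    intro x
    ext v
    simp only [M, Matrix.add_mulVec, Pi.add_apply, Matrix.mulVec_diagonal,
      SimpleGraph.adjMatrix_mulVec_apply, signlessMul]
    rw [← Finset.sum_filter, Finset.sum_add_distrib, Finset.sum_const, nsmul_eq_mul,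
      ← SimpleGraph.neighborFinset_eq_filter, SimpleGraph.card_neighborFinset_eq_degree]
  have hM : M.IsHermitian := by
    refine Matrix.IsHermitian.add (Matrix.isHermitian_diagonal _) ?_
    simp [Matrix.IsHermitian, Matrix.conjTranspose_eq_transpose_of_trivial]
  obtain ⟨h1, h2⟩ := hM.sSup_eigenvalues_mem_and_posSemidef
  have hq : qIndex G = sSup {μ : ℝ | ∃ x : V → ℝ, x ≠ 0 ∧ M.mulVec x = μ • x} := by
    simp only [qIndex, M]
  rw [← hq] at h1 h2
  have hform : ∀ x : V → ℝ, star x ⬝ᵥ (qIndex G • (1 : Matrix V V ℝ) - M).mulVec x =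
      qIndex G * ∑ v, x v ^ 2 - ∑ v, x v * signlessMul G x v := by
    intro x
    rw [Matrix.sub_mulVec, Matrix.smul_mulVec, Matrix.one_mulVec, hmul, dotProduct_sub,
      dotProduct_smul]
    simp [dotProduct, pow_two]
  refine ⟨?_, ?_, ?_⟩
  · obtain ⟨x, hx, h⟩ := h1
    refine ⟨x, hx, fun v => ?_⟩
    rw [← hmul, h]; simp
  · intro x
    have := h2.dotProduct_mulVec_nonneg x
    rw [hform] at this
    linarith
  · intro x hx v
    have := (h2.dotProduct_mulVec_zero_iff x).1 (by rw [hform]; linarith)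
    rw [Matrix.sub_mulVec, Matrix.smul_mulVec, Matrix.one_mulVec, hmul] at this
    have := congrFun this v
    simp at this
    linarith

omit [DecidableEq V] in
theorem sum_mul_signlessMul (G : SimpleGraph V) (x : V → ℝ) :
    open Classical in
    2 * ∑ v, x v * signlessMul G x v = ∑ v, ∑ u, if G.Adj v u then (x v + x u) ^ 2 else 0 := by
  classical
  have h1 : ∑ v, x v * signlessMul G x v =
      ∑ v, ∑ u, if G.Adj v u then x v * (x v + x u) else 0 := by
    simp [signlessMul, Finset.mul_sum]
  have h2 : ∑ v, x v * signlessMul G x v =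
      ∑ v, ∑ u, if G.Adj v u then x u * (x v + x u) else 0 := by
    rw [h1, Finset.sum_comm]
    refine Finset.sum_congr rfl fun v _ => Finset.sum_congr rfl fun u _ => ?_
    simp only [G.adj_comm u v, add_comm]
  rw [two_mul]
  nth_rw 1 [h1]
  rw [h2, ← Finset.sum_add_distrib]
  refine Finset.sum_congr rfl fun v _ => ?_
  rw [← Finset.sum_add_distrib]
  refine Finset.sum_congr rfl fun u _ => ?_
  split_ifs <;> ring

/-- A positive test vector bounds the `Q`-index from above. -/
theorem exists_qIndex_mul_le [Nonempty V] (G : SimpleGraph V) (z : V → ℝ) (hz : ∀ v, 0 < z v) :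
    ∃ v, qIndex G * z v ≤ signlessMul G z v := by
  classical
  obtain ⟨⟨x, hx, h⟩, -⟩ := signlessMul_spec G
  obtain ⟨v, -, hv⟩ := Finset.exists_max_image Finset.univ (fun v => |x v| / z v)
    Finset.univ_nonempty
  have hc : ∀ u, |x u| ≤ |x v| / z v * z u := fun u => by
    have := hv u (Finset.mem_univ u)
    rwa [div_le_iff₀ (hz u)] at this
  have hpos : 0 < |x v| / z v := by
    obtain ⟨u, hu⟩ := Function.ne_iff.1 hx
    have h1 : 0 < |x u| := abs_pos.2 (by simpa using hu)
    have h2 := hc u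
    by_contra! h3
    nlinarith [hz u]
  refine ⟨v, ?_⟩
  have hxv : |x v| = |x v| / z v * z v := by
    field_simp [(hz v).ne']
  have key : |x v| * qIndex G ≤ |x v| / z v * signlessMul G z v := by
    calc |x v| * qIndex G ≤ |qIndex G * x v| := by
          rw [abs_mul, mul_comm]
          exact mul_le_mul_of_nonneg_right (le_abs_self _) (abs_nonneg _)
      _ = |signlessMul G x v| := by rw [h]
      _ ≤ ∑ u, |if G.Adj v u then x v + x u else 0| := Finset.abs_sum_le_sum_abs _ _
      _ ≤ ∑ u, |x v| / z v * (if G.Adj v u then z v + z u else 0) := by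
          refine Finset.sum_le_sum fun u _ => ?_
          split_ifs
          · calc |x v + x u| ≤ |x v| + |x u| := abs_add_le _ _
              _ ≤ _ := by rw [mul_add]; exact add_le_add hxv.le (hc u)
          · simp
      _ = _ := by rw [← Finset.mul_sum]; simp only [signlessMul]
  generalize |x v| / z v = c at *
  rw [hxv, mul_assoc] at key
  have := le_of_mul_le_mul_left key hpos
  linarith

theorem qIndex_mono [Nonempty V] {G H : SimpleGraph V} (h : G ≤ H) : qIndex G ≤ qIndex H := by
  classical
  obtain ⟨⟨x, hx, hG⟩, -⟩ := signlessMul_spec G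
  have hH := (signlessMul_spec H).2.1 x
  have e1 := sum_mul_signlessMul G x
  have e2 := sum_mul_signlessMul H x
  have : ∑ v, ∑ u, (if G.Adj v u then (x v + x u) ^ 2 else 0) ≤
      ∑ v, ∑ u, (if H.Adj v u then (x v + x u) ^ 2 else 0) := by
    refine Finset.sum_le_sum fun v _ => Finset.sum_le_sum fun u _ => ?_
    by_cases h1 : G.Adj v u
    · simp [h1, h h1]
    · simp only [h1, if_false]; positivity
  have e3 : ∑ v, x v * signlessMul G x v = qIndex G * ∑ v, x v ^ 2 := by
    rw [Finset.mul_sum]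
    exact Finset.sum_congr rfl fun v _ => by rw [hG]; ring
  have hpos : 0 < ∑ v, x v ^ 2 := by
    obtain ⟨u, hu⟩ := Function.ne_iff.1 hx
    exact Finset.sum_pos' (fun _ _ => sq_nonneg _) ⟨u, Finset.mem_univ u, by
      have : x u ≠ 0 := hu
      positivity⟩
  have : qIndex G * ∑ v, x v ^ 2 ≤ qIndex H * ∑ v, x v ^ 2 := by linarith
  exact le_of_mul_le_mul_right this hpos

/-- Strict monotonicity of the `Q`-index below a connected graph. -/
theorem eq_of_le_of_qIndex_le {G H : SimpleGraph V} (h : G ≤ H) (hH : H.Connected)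
    (hq : qIndex H ≤ qIndex G) : G = H := by
  classical
  have := hH.nonempty
  obtain ⟨⟨x, hx, hG⟩, -⟩ := signlessMul_spec G
  let y : V → ℝ := fun v => |x v|
  have hy0 : ∀ v, 0 ≤ y v := fun v => abs_nonneg _
  obtain ⟨-, hr, heq⟩ := signlessMul_spec H
  have hr := hr y
  have heq := heq y
  have e1 := sum_mul_signlessMul G x
  have e2 := sum_mul_signlessMul H y
  have hle : ∀ v u, (if G.Adj v u then (x v + x u) ^ 2 else 0) ≤
      (if H.Adj v u then (y v + y u) ^ 2 else 0) := by
    intro v u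
    by_cases h1 : G.Adj v u
    · simp only [h1, h h1, if_true]
      rw [← sq_abs (x v + x u)]
      exact pow_le_pow_left₀ (abs_nonneg _) (abs_add_le _ _) 2
    · simp only [h1, if_false]; positivity
  have e3 : ∑ v, x v * signlessMul G x v = qIndex G * ∑ v, x v ^ 2 := by
    rw [Finset.mul_sum]
    exact Finset.sum_congr rfl fun v _ => by rw [hG]; ring
  have e4 : ∑ v, x v ^ 2 = ∑ v, y v ^ 2 := by simp [y]
  have hs : ∑ v, ∑ u, (if G.Adj v u then (x v + x u) ^ 2 else 0) ≤
      ∑ v, ∑ u, (if H.Adj v u then (y v + y u) ^ 2 else 0) :=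
    Finset.sum_le_sum fun v _ => Finset.sum_le_sum fun u _ => hle v u
  have hqq : qIndex H * ∑ v, y v ^ 2 ≤ qIndex G * ∑ v, y v ^ 2 :=
    mul_le_mul_of_nonneg_right hq (Finset.sum_nonneg fun _ _ => sq_nonneg _)
  rw [e4] at e3
  have hev := heq (by linarith)
  have hnbr : ∀ v u, H.Adj v u → y v = 0 → y u = 0 := by
    intro v u hvu hv
    have h0 : signlessMul H y v = 0 := by rw [hev, hv, mul_zero]
    rw [signlessMul, Finset.sum_eq_zero_iff_of_nonneg] at h0
    · have := h0 u (Finset.mem_univ u)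
      simpa [hvu, hv] using this
    · intro w _
      split_ifs
      · exact add_nonneg (hy0 _) (hy0 _)
      · exact le_rfl
  have hposy : ∀ v, 0 < y v := by
    intro v
    refine lt_of_le_of_ne (hy0 v) fun hv => ?_
    have hall : ∀ u, y u = 0 := by
      intro u
      obtain ⟨p⟩ := hH.preconnected v u
      induction p with
      | nil => exact hv.symm
      | cons hadj p ih => exact ih (hnbr _ _ hadj hv.symm).symm
    exact hx (funext fun u => by simpa [y] using hall u)
  refine le_antisymm h fun a b hab => ?_
  by_contra hn
  have hlt : ∑ v, ∑ u, (if G.Adj v u then (x v + x u) ^ 2 else 0) <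
      ∑ v, ∑ u, (if H.Adj v u then (y v + y u) ^ 2 else 0) := by
    refine Finset.sum_lt_sum (fun v _ => Finset.sum_le_sum fun u _ => hle v u)
      ⟨a, Finset.mem_univ a, Finset.sum_lt_sum (fun u _ => hle a u) ⟨b, Finset.mem_univ b, ?_⟩⟩
    simp only [hn, hab, if_true, if_false]
    have := hposy a
    have := hposy b
    positivity
  linarith

theorem qIndex_le_of_iso {W : Type*} [Fintype W] [DecidableEq W] [Nonempty V]
    {G : SimpleGraph V} {H : SimpleGraph W} (e : G ≃g H) : qIndex G ≤ qIndex H := by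
  classical
  have : Nonempty W := ‹Nonempty V›.map e
  obtain ⟨⟨x, hx, hG⟩, -⟩ := signlessMul_spec G
  have hH := (signlessMul_spec H).2.1 (x ∘ e.symm)
  have hm : ∀ v, signlessMul H (x ∘ e.symm) (e v) = signlessMul G x v := by
    intro v
    simp only [signlessMul]
    rw [← Equiv.sum_comp e.toEquiv]
    refine Finset.sum_congr rfl fun u _ => ?_
    have : H.Adj (e v) (e.toEquiv u) ↔ G.Adj v u := e.map_adj_iff
    simp only [this]
    simp
  rw [← Equiv.sum_comp e.toEquiv, ← Equiv.sum_comp e.toEquiv] at hH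
  have hH' : ∑ v, x v * signlessMul G x v ≤ qIndex H * ∑ v, x v ^ 2 := by
    refine le_of_eq_of_le ?_ (hH.trans_eq ?_)
    · refine Finset.sum_congr rfl fun v _ => ?_
      rw [← hm]; simp
    · simp
  have e3 : ∑ v, x v * signlessMul G x v = qIndex G * ∑ v, x v ^ 2 := by
    rw [Finset.mul_sum]
    exact Finset.sum_congr rfl fun v _ => by rw [hG]; ring
  have hpos : 0 < ∑ v, x v ^ 2 := by
    obtain ⟨u, hu⟩ := Function.ne_iff.1 hx
    exact Finset.sum_pos' (fun _ _ => sq_nonneg _) ⟨u, Finset.mem_univ u, by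
      have : x u ≠ 0 := hu
      positivity⟩
  rw [e3] at hH'
  exact le_of_mul_le_mul_right hH' hpos

end Spectral

section HamiltonianLists

theorem SimpleGraph.Walk.IsPath.isCycle_cons_of_two_le_length {V : Type*} {G : SimpleGraph V}
    {u v : V} {p : G.Walk u v} (hP : p.IsPath) (h : G.Adj v u) (hl : 2 ≤ p.length) :
    (Walk.cons h p).IsCycle := by
  rw [Walk.cons_isCycle_iff]
  refine ⟨hP, fun hmem => ?_⟩
  cases p with
  | nil => simp at hmem
  | cons h1 q =>
    rw [Walk.cons_isPath_iff] at hP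
    rw [Walk.edges_cons, List.mem_cons] at hmem
    rcases hmem with hmem | hmem
    · rw [Sym2.eq_iff] at hmem
      rcases hmem with ⟨h2, h3⟩ | ⟨h2, h3⟩
      · exact hP.2 (h2 ▸ q.end_mem_support)
      · subst h2
        have := (Walk.isPath_iff_nil.1 hP.1).length_eq_zero
        simp [this] at hl
    · exact hP.2 (Walk.snd_mem_support_of_mem_edges _ hmem)

variable {V : Type*} [Fintype V] [DecidableEq V]

/-- A list enumerating the vertices along a Hamiltonian cycle. -/
structure IsHamiltonianList (G : SimpleGraph V) (l : List V) : Prop where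
  nodup : l.Nodup
  mem : ∀ v, v ∈ l
  chain : l.IsChain G.Adj
  closed : ∀ a ∈ l.getLast?, ∀ b ∈ l.head?, G.Adj a b

theorem IsHamiltonianList.isHamiltonian {G : SimpleGraph V} {l : List V}
    (h : IsHamiltonianList G l) (hc : 3 ≤ Fintype.card V) : G.IsHamiltonian := by
  intro _
  have hlen : l.length = Fintype.card V := by
    rw [← List.toFinset_card_of_nodup h.nodup, Finset.card_eq_of_equiv_fin]
    rw [show l.toFinset = Finset.univ from Finset.eq_univ_iff_forall.2 (by simpa using h.mem)]
    exact (Finset.equivFin _).trans (finCongr (by simp))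
  have hne : l ≠ [] := by rintro rfl; simp at hlen; omega
  have hadj : G.Adj (l.getLast hne) (l.head hne) :=
    h.closed _ (by simp [List.getLast?_eq_getLast_of_ne_nil hne]) _ (by simp [List.head?_eq_some_head hne])
  have hP : (Walk.ofSupport l hne h.chain).IsPath := by
    apply Walk.IsPath.mk'
    rw [Walk.support_ofSupport]; exact h.nodup
  have hcyc := hP.isCycle_cons_of_two_le_length hadj (by rw [Walk.length_ofSupport]; omega)
  refine ⟨_, _, (Walk.isHamiltonianCycle_iff_isCycle_and_length_eq).2 ⟨hcyc, ?_⟩⟩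
  rw [Walk.length_cons, Walk.length_ofSupport]
  omega

theorem SimpleGraph.IsHamiltonian.exists_isHamiltonianList {G : SimpleGraph V}
    (h : G.IsHamiltonian) (hc : 3 ≤ Fintype.card V) (x : V) :
    ∃ l, IsHamiltonianList G (x :: l) := by
  have : Nontrivial V := Fintype.one_lt_card_iff_nontrivial.1 (by omega)
  obtain ⟨p, hp⟩ := h.exists_isHamiltonianCycle x
  refine ⟨p.support.tail.dropLast, ?_⟩
  cases p with
  | nil => exact absurd rfl hp.isCycle.ne_nil
  | cons h1 q =>
    have hq := (Walk.isHamiltonianCycle_iff_isCycle_and_support_count_tail_eq_one.1 hp).2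
    simp only [Walk.support_cons, List.tail_cons] at hq
    have hd : q.support.dropLast ++ [x] = q.support := by
      conv_rhs => rw [← List.dropLast_append_getLast q.support_ne_nil]
      rw [Walk.getLast_support]
    have hq' : q.support.Nodup := List.nodup_iff_count_le_one.2 fun v => (hq v).le
    have hchain : (x :: q.support).IsChain G.Adj := Walk.isChain_adj_support (Walk.cons h1 q)
    rw [← hd] at hq' hchain
    simp only [Walk.support_cons, List.tail_cons]
    refine ⟨?_, ?_, ?_, ?_⟩
    · grind
    · intro v
      have : v ∈ q.support := List.count_pos_iff.1 (by rw [hq v]; exact one_pos)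
      rw [← hd] at this
      grind
    · rw [← List.cons_append] at hchain
      exact hchain.left_of_append
    · rw [← List.cons_append, List.isChain_append] at hchain
      intro a ha b hb
      exact hchain.2.2 a ha b (by simpa using hb)

end HamiltonianLists

section LocalCompletion

variable {V : Type*}

open Classical in
/-- The number of consecutive pairs of a list having exactly one member in `L`. -/
noncomputable def crossings (L : Set V) : List V → ℕ
  | [] => 0
  | [_] => 0
  | a :: b :: l => (if (a ∈ L ↔ b ∈ L) then 0 else 1) + crossings L (b :: l)

theorem crossings_append_cons_cons (L : Set V) (A B : List V) (a b : V) :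
    open Classical in
    crossings L (A ++ a :: b :: B) =
      crossings L (A ++ [a]) + (if (a ∈ L ↔ b ∈ L) then 0 else 1) + crossings L (b :: B) := by
  classical
  induction A with
  | nil => simp [crossings]
  | cons c A ih =>
    cases A with
    | nil => simp [crossings]; ring
    | cons d A =>
      simp only [List.cons_append, crossings] at ih ⊢
      rw [ih]; ring

theorem crossings_reverse (L : Set V) (P : List V) : crossings L P.reverse = crossings L P := by
  classical
  induction P with
  | nil => simp
  | cons a P ih =>
    cases P with
    | nil => simp
    | cons b P =>
      simp only [List.reverse_cons, List.append_assoc, List.cons_append, List.nil_append] at ih ⊢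
      rw [crossings_append_cons_cons, ih]
      simp only [crossings, iff_comm (a := b ∈ L)]
      ring

theorem crossings_append (L : Set V) (A B : List V) (hA : ∀ a ∈ A.getLast?, a ∈ L)
    (hB : ∀ b ∈ B.head?, b ∈ L) : crossings L (A ++ B) = crossings L A + crossings L B := by
  rcases A.eq_nil_or_concat' with rfl | ⟨A, a, rfl⟩
  · simp [crossings]
  cases B with
  | nil => simp [crossings]
  | cons b B =>
    simp only [List.getLast?_append, List.getLast?_singleton, Option.some_or, Option.mem_def, List.head?_cons, Option.some.injEq,
      forall_eq'] at hA hB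
    simp [crossings_append_cons_cons, hA, hB]

/-- A nonempty chain of adjacent vertices whose two ends lie in `L`. -/
structure IsEndedChain (H : SimpleGraph V) (L : Set V) (P : List V) : Prop where
  ne_nil : P ≠ []
  chain : P.IsChain H.Adj
  head : ∀ a ∈ P.head?, a ∈ L
  last : ∀ a ∈ P.getLast?, a ∈ L

theorem IsEndedChain.reverse {H : SimpleGraph V} {L : Set V} {P : List V}
    (h : IsEndedChain H L P) : IsEndedChain H L P.reverse where
  ne_nil := by simpa using h.ne_nil
  chain := by simpa [List.isChain_reverse, H.adj_comm] using h.chain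
  head := by simpa using h.last
  last := by simpa using h.head

theorem IsEndedChain.append {H : SimpleGraph V} {L : Set V} {P Q : List V}
    (hP : IsEndedChain H L P) (hQ : IsEndedChain H L Q)
    (h : ∀ a ∈ P.getLast?, ∀ b ∈ Q.head?, H.Adj a b) : IsEndedChain H L (P ++ Q) where
  ne_nil := by simp [hP.ne_nil]
  chain := hP.chain.append hQ.chain h
  head := by
    rw [List.head?_append_of_ne_nil _ hP.ne_nil]
    exact hP.head
  last := by
    rw [List.getLast?_append_of_ne_nil _ hQ.ne_nil]
    exact hQ.last

/-- `P` can be rearranged to start at `u`, without more crossings. -/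
def Startable (H : SimpleGraph V) (L : Set V) (P : List V) (u : V) : Prop :=
  ∃ P' : List V, P'.Perm P ∧ IsEndedChain H L P' ∧ P'.head? = some u ∧
    crossings L P' = crossings L P

theorem IsEndedChain.startable_head {H : SimpleGraph V} {L : Set V} {P : List V}
    (h : IsEndedChain H L P) {u : V} (hu : P.head? = some u) : Startable H L P u :=
  ⟨P, .refl _, h, hu, rfl⟩

theorem IsEndedChain.startable_getLast {H : SimpleGraph V} {L : Set V} {P : List V}
    (h : IsEndedChain H L P) {u : V} (hu : P.getLast? = some u) : Startable H L P u :=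
  ⟨P.reverse, P.reverse_perm, h.reverse, by simpa using hu, crossings_reverse L P⟩

/-- A closable chain through a neighbour `u` of `x` can be rearranged to start at `u`, unless `u`
can be cut out of it. -/
theorem IsEndedChain.startable_or_excise {H : SimpleGraph V} (hclaw : ClawFree H) {x : V}
    {P : List V} (h : IsEndedChain H (H.neighborSet x) P) (hnd : P.Nodup) (hx : x ∉ P)
    (hclose : ∀ a ∈ P.head?, ∀ b ∈ P.getLast?, a = b ∨ H.Adj b a)
    {u : V} (hu : u ∈ P) (hxu : H.Adj x u) :
    Startable H (H.neighborSet x) P u ∨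
    ∃ P', (u :: P').Perm P ∧ IsEndedChain H (H.neighborSet x) P' ∧
      crossings (H.neighborSet x) P' + 2 ≤ crossings (H.neighborSet x) P := by
  classical
  obtain ⟨A, B, rfl⟩ := List.append_of_mem hu
  rcases A.eq_nil_or_concat' with rfl | ⟨A, s, rfl⟩
  · exact Or.inl (h.startable_head (by simp))
  rcases B with _ | ⟨t, B⟩
  · exact Or.inl (h.startable_getLast (by simp))
  have hch := h.chain
  have hhead := h.head
  have hlast := h.last
  have hst : s ≠ t := by rintro rfl; simp [List.nodup_append] at hnd
  simp only [List.append_assoc, List.cons_append, List.nil_append] at *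
  have hA : (A ++ [s]).IsChain H.Adj ∧ H.Adj s u ∧ H.Adj u t ∧ (t :: B).IsChain H.Adj := by
    rw [List.isChain_append_cons_cons, List.isChain_cons_cons] at hch
    exact ⟨hch.1, hch.2.1, hch.2.2.1, hch.2.2.2⟩
  obtain ⟨hA, hsu, hut, hB⟩ := hA
  have hhd : (A ++ s :: u :: t :: B).head? = (A ++ [s]).head? := by
    cases A <;> simp
  have hlt : (A ++ s :: u :: t :: B).getLast? = (t :: B).getLast? := by
    rw [List.getLast?_append_of_ne_nil _ (by simp), List.getLast?_cons_cons, List.getLast?_cons_cons]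
  rw [hhd] at hhead hclose
  rw [hlt] at hlast hclose
  have hclose' : ∀ b ∈ (t :: B).getLast?, ∀ a ∈ (A ++ [s]).head?, H.Adj b a := by
    intro b hb a ha
    refine (hclose a ha b hb).resolve_left ?_
    rintro rfl
    have h1 : a ∈ A ++ [s] := List.mem_of_mem_head? ha
    have h2 : a ∈ t :: B := List.mem_of_mem_getLast? hb
    grind
  by_cases ht : H.Adj x t
  · left
    have hAu : IsEndedChain H (H.neighborSet x) (A ++ [s, u]) := by
      refine ⟨by simp, ?_, ?_, by simpa using hxu⟩
      · rw [List.isChain_append_cons_cons]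
        exact ⟨hA, hsu, by simp⟩
      · cases A <;> simpa using hhead
    have htB : IsEndedChain H (H.neighborSet x) (t :: B) :=
      ⟨by simp, hB, by simpa using ht, hlast⟩
    have := htB.append hAu (fun b hb a ha => hclose' b hb a (by cases A <;> simpa using ha))
    refine ⟨((t :: B) ++ (A ++ [s, u])).reverse, ?_, this.reverse, by simp, ?_⟩
    · refine (List.reverse_perm _).trans (List.perm_append_comm.trans ?_)
      simp only [List.append_assoc, List.cons_append, List.nil_append]
      exact .refl _
    · rw [crossings_reverse, crossings_append _ _ _ hlast hAu.head]
      have h1 : t ∈ H.neighborSet x := ht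
      have h2 : u ∈ H.neighborSet x := hxu
      have h3 := crossings_append_cons_cons (H.neighborSet x) (A ++ [s]) B u t
      simp only [h1, h2, List.append_assoc, List.cons_append, List.nil_append] at h3
      simp only [h3, if_true]
      ring
  by_cases hs : H.Adj x s
  · left
    have hAs : IsEndedChain H (H.neighborSet x) (A ++ [s]) :=
      ⟨by simp, hA, hhead, by simpa using hs⟩
    have huB : IsEndedChain H (H.neighborSet x) (u :: t :: B) :=
      ⟨by simp, List.isChain_cons_cons.2 ⟨hut, hB⟩, by simpa using hxu,
        by simpa [List.getLast?_cons_cons] using hlast⟩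
    have := huB.append hAs (fun b hb a ha =>
      hclose' b (by simpa [List.getLast?_cons_cons] using hb) a ha)
    refine ⟨_, ?_, this, by simp, ?_⟩
    · refine List.perm_append_comm.trans ?_
      simp
    · rw [crossings_append _ _ _ huB.last hAs.head, crossings_append_cons_cons]
      have h1 : s ∈ H.neighborSet x := hs
      have h2 : u ∈ H.neighborSet x := hxu
      simp only [h1, h2]
      simp; ring
  · right
    have hadj : H.Adj s t := by
      by_contra hn
      refine hclaw ⟨u, x, s, t, ?_, ?_, hst, hxu.symm, hsu.symm, hut, hs, ht, hn⟩
      · rintro rfl; simp at hx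
      · rintro rfl; simp at hx
    refine ⟨A ++ s :: t :: B, ?_, ⟨by simp, ?_, ?_, ?_⟩, ?_⟩
    · grind
    · rw [List.isChain_append_cons_cons]
      exact ⟨hA, hadj, hB⟩
    · cases A <;> simpa using hhead
    · simpa [List.getLast?_cons_cons, List.getLast?_append] using hlast
    · rw [show A ++ s :: u :: t :: B = (A ++ [s]) ++ u :: t :: B by simp,
        crossings_append_cons_cons, crossings_append_cons_cons]
      simp only [List.append_assoc, List.cons_append, List.nil_append]
      rw [crossings_append_cons_cons]
      have h1 : s ∉ H.neighborSet x := hs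
      have h2 : u ∈ H.neighborSet x := hxu
      have h3 : t ∉ H.neighborSet x := ht
      simp only [h1, h2, h3]
      simp [crossings]; omega

/-- Disjoint chains ending in `L` that together cover everything but `x`. -/
structure IsChainCover (H : SimpleGraph V) (L : Set V) (x : V) (Ps : List (List V)) : Prop where
  ended : ∀ P ∈ Ps, IsEndedChain H L P
  nodup : Ps.flatten.Nodup
  mem : ∀ v, v ∈ Ps.flatten ↔ v ≠ x

noncomputable def coverCost (L : Set V) (Ps : List (List V)) : ℕ :=
  (Ps.map fun P => 1 + crossings L P).sum

theorem IsChainCover.perm {H : SimpleGraph V} {L : Set V} {x : V} {Ps Qs : List (List V)}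
    (h : IsChainCover H L x Ps) (hQ : ∀ P ∈ Qs, IsEndedChain H L P)
    (hp : Qs.flatten.Perm Ps.flatten) : IsChainCover H L x Qs :=
  ⟨hQ, hp.nodup_iff.2 h.nodup, fun v => by rw [hp.mem_iff, h.mem]⟩

variable [Fintype V] [DecidableEq V]

theorem IsChainCover.isHamiltonian {H : SimpleGraph V} (hclaw : ClawFree H)
    (hc : 3 ≤ Fintype.card V) {x : V}
    (hconn : ∀ X : Set V, (∃ a ∈ X, H.Adj x a) → (∃ b ∉ X, H.Adj x b) →
      ∃ a ∈ X, ∃ b ∉ X, H.Adj x a ∧ H.Adj x b ∧ H.Adj a b) (Ps : List (List V))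
    (h : IsChainCover H (H.neighborSet x) x Ps) : H.IsHamiltonian := by
  classical
  induction hcost : coverCost (H.neighborSet x) Ps using Nat.strong_induction_on generalizing Ps with
  | _ c ih =>
  subst hcost
  have hxP : ∀ P ∈ Ps, x ∉ P := fun P hP hx =>
    (h.mem x).1 (List.mem_flatten.2 ⟨P, hP, hx⟩) rfl
  have hndP : ∀ P ∈ Ps, P.Nodup := (List.nodup_flatten.1 h.nodup).1
  rcases Ps with _ | ⟨P, Ps⟩
  · exfalso
    have := Fintype.exists_ne_of_one_lt_card (by omega : 1 < Fintype.card V) x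
    obtain ⟨v, hv⟩ := this
    simpa using (h.mem v).2 hv
  have hP := h.ended P (by simp)
  rcases Ps with _ | ⟨Q₀, Ps⟩
  · refine IsHamiltonianList.isHamiltonian (l := x :: P) ⟨?_, ?_, ?_, ?_⟩ hc
    · have := hxP P (by simp)
      have := hndP P (by simp)
      grind
    · intro v
      have := h.mem v
      simp at this ⊢
      tauto
    · rw [List.isChain_cons]
      exact ⟨hP.head, hP.chain⟩
    · intro a ha b hb
      simp at hb
      subst hb
      refine (hP.last a ?_ : H.Adj x a).symm
      have := hP.ne_nil
      grind
  have hQ₀ := h.ended Q₀ (by simp)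
  obtain ⟨p, hp⟩ := Option.ne_none_iff_exists'.1 (mt List.head?_eq_none_iff.1 hP.ne_nil)
  obtain ⟨q₀, hq₀⟩ := Option.ne_none_iff_exists'.1 (mt List.head?_eq_none_iff.1 hQ₀.ne_nil)
  have hdisj : ∀ Q ∈ Q₀ :: Ps, ∀ v ∈ P, v ∉ Q := by
    intro Q hQ v hv hv'
    have := (List.nodup_flatten.1 h.nodup).2
    rw [List.pairwise_cons] at this
    exact this.1 Q hQ hv hv'
  obtain ⟨u, hu, w, hw, hxu, hxw, huw⟩ := hconn {v | v ∈ P}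
    ⟨p, List.mem_of_mem_head? hp, hP.head p hp⟩
    ⟨q₀, fun h1 => hdisj Q₀ (by simp) q₀ h1 (List.mem_of_mem_head? hq₀), hQ₀.head q₀ hq₀⟩
  have hwx : w ≠ x := hxw.ne'
  obtain ⟨Q, hQmem, hwQ⟩ : ∃ Q ∈ Q₀ :: Ps, w ∈ Q := by
    have := (h.mem w).2 hwx
    rw [List.flatten_cons, List.mem_append] at this
    exact List.mem_flatten.1 (this.resolve_left hw)
  obtain ⟨R, hR⟩ : ∃ R, (Q₀ :: Ps).Perm (Q :: R) := ⟨_, List.perm_cons_erase hQmem⟩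
  have hperm : (P :: Q₀ :: Ps).Perm (P :: Q :: R) := hR.cons P
  have hcosteq : coverCost (H.neighborSet x) (P :: Q₀ :: Ps) = coverCost (H.neighborSet x) (P :: Q :: R) :=
    (hperm.map _).sum_eq
  have hQ := h.ended Q (by simp at hQmem ⊢; tauto)
  have hndQ : Q.Nodup := hndP Q (by simp at hQmem ⊢; tauto)
  have hxQ : x ∉ Q := hxP Q (by simp at hQmem ⊢; tauto)
  have hPQ := hdisj Q hQmem
  have h' : IsChainCover H (H.neighborSet x) x (P :: Q :: R) :=
    h.perm (fun T hT => h.ended T (hperm.mem_iff.2 hT)) hperm.symm.flatten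
  rw [hcosteq] at ih
  have hRend : ∀ T ∈ R, IsEndedChain H (H.neighborSet x) T := fun T hT => h'.ended T (by simp [hT])
  -- joining two chains at adjacent starting points
  have hmerge : ∀ u w, Startable H (H.neighborSet x) P u → Startable H (H.neighborSet x) Q w → H.Adj u w → H.IsHamiltonian := by
    rintro u w ⟨P', hP1, hP2, hP3, hP4⟩ ⟨Q', hQ1, hQ2, hQ3, hQ4⟩ huw
    have hend : IsEndedChain H (H.neighborSet x) (P'.reverse ++ Q') := by
      refine hP2.reverse.append hQ2 ?_
      rw [List.getLast?_reverse, hP3, hQ3]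
      rintro a ha b hb
      simp at ha hb
      subst ha hb
      exact huw
    refine ih _ ?_ ((P'.reverse ++ Q') :: R) (h'.perm ?_ ?_) rfl
    · simp only [coverCost, List.map_cons, List.sum_cons]
      rw [crossings_append _ _ _ hP2.reverse.last hQ2.head, crossings_reverse, hP4, hQ4]
      omega
    · simpa using ⟨hend, hRend⟩
    · simp only [List.flatten_cons]
      rw [← List.append_assoc]
      exact (((P'.reverse_perm.trans hP1).append hQ1).append_right _)
  obtain ⟨p', hp'⟩ := Option.ne_none_iff_exists'.1 (mt List.getLast?_eq_none_iff.1 hP.ne_nil)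
  obtain ⟨q, hq⟩ := Option.ne_none_iff_exists'.1 (mt List.head?_eq_none_iff.1 hQ.ne_nil)
  obtain ⟨q', hq'⟩ := Option.ne_none_iff_exists'.1 (mt List.getLast?_eq_none_iff.1 hQ.ne_nil)
  have hpP := List.mem_of_mem_head? hp
  have hp'P := List.mem_of_mem_getLast? hp'
  have hqQ := List.mem_of_mem_head? hq
  have hq'Q := List.mem_of_mem_getLast? hq'
  by_cases e1 : H.Adj p q
  · exact hmerge _ _ (hP.startable_head hp) (hQ.startable_head hq) e1
  by_cases e2 : H.Adj p q'
  · exact hmerge _ _ (hP.startable_head hp) (hQ.startable_getLast hq') e2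
  by_cases e3 : H.Adj p' q
  · exact hmerge _ _ (hP.startable_getLast hp') (hQ.startable_head hq) e3
  have hxp : H.Adj x p := hP.head p hp
  have hxp' : H.Adj x p' := hP.last p' hp'
  have hxq : H.Adj x q := hQ.head q hq
  have hxq' : H.Adj x q' := hQ.last q' hq'
  have hne : ∀ a ∈ P, ∀ b ∈ Q, a ≠ b := fun a ha b hb hab => hPQ a ha (hab ▸ hb)
  have hcP : p = p' ∨ H.Adj p' p := by
    by_contra! hn
    exact hclaw ⟨x, p, p', q, hn.1, hne _ hpP _ hqQ, hne _ hp'P _ hqQ, hxp, hxp', hxq,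
      fun h => hn.2 h.symm, e1, e3⟩
  have hcQ : q = q' ∨ H.Adj q' q := by
    by_contra! hn
    exact hclaw ⟨x, q, q', p, hn.1, (hne _ hpP _ hqQ).symm, (hne _ hpP _ hq'Q).symm, hxq, hxq',
      hxp, fun h => hn.2 h.symm, fun h => e1 h.symm, fun h => e2 h.symm⟩
  rcases hP.startable_or_excise hclaw (hndP P (by simp)) (hxP P (by simp))
      (by rw [hp, hp']; simpa using hcP) hu hxu with hPu | ⟨P', hP1, hP2, hP3⟩
  · rcases hQ.startable_or_excise hclaw hndQ hxQ
      (by rw [hq, hq']; simpa using hcQ) hwQ hxw with hQw | ⟨Q', hQ1, hQ2, hQ3⟩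
    · exact hmerge _ _ hPu hQw huw
    · refine ih _ ?_ ([w] :: Q' :: P :: R) (h'.perm ?_ ?_) rfl
      · simp only [coverCost, List.map_cons, List.sum_cons, crossings]
        omega
      · have : IsEndedChain H (H.neighborSet x) [w] := ⟨by simp, by simp, by simpa using hxw, by simpa using hxw⟩
        simpa using ⟨this, hQ2, hP, hRend⟩
      · simp only [List.flatten_cons]
        rw [← List.append_assoc, ← List.append_assoc, ← List.append_assoc P]
        exact ((hQ1.append_right P).trans List.perm_append_comm).append_right _
  · refine ih _ ?_ ([u] :: P' :: Q :: R) (h'.perm ?_ ?_) rfl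
    · simp only [coverCost, List.map_cons, List.sum_cons, crossings]
      omega
    · have : IsEndedChain H (H.neighborSet x) [u] := ⟨by simp, by simp, by simpa using hxu, by simpa using hxu⟩
      simpa using ⟨this, hP2, hQ, hRend⟩
    · simp only [List.flatten_cons]
      rw [← List.append_assoc]
      exact hP1.append_right _

end LocalCompletion

section Closure

variable {V : Type*}

/-- The graph obtained from `H` by making the neighbourhood of `x` a clique. -/
def localCompletion (H : SimpleGraph V) (x : V) : SimpleGraph V where
  Adj u v := H.Adj u v ∨ (u ≠ v ∧ H.Adj x u ∧ H.Adj x v)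
  symm := ⟨fun u v h => by
    rcases h with h | ⟨h1, h2, h3⟩
    · exact Or.inl h.symm
    · exact Or.inr ⟨h1.symm, h3, h2⟩⟩
  loopless := ⟨fun u h => by simp at h⟩

theorem localCompletion_adj {H : SimpleGraph V} {x u v : V} :
    (localCompletion H x).Adj u v ↔ H.Adj u v ∨ (u ≠ v ∧ H.Adj x u ∧ H.Adj x v) := Iff.rfl

theorem le_localCompletion (H : SimpleGraph V) (x : V) : H ≤ localCompletion H x :=
  fun _ _ h => Or.inl h

theorem clawFree_localCompletion {H : SimpleGraph V} (hclaw : ClawFree H) (x : V) :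
    ClawFree (localCompletion H x) := by
  have key : ∀ z a b c, a ≠ b → a ≠ c → b ≠ c → (localCompletion H x).Adj z a →
      (localCompletion H x).Adj z b → H.Adj x z → H.Adj x c →
      ¬ (localCompletion H x).Adj a b → ¬ (localCompletion H x).Adj a c →
      ¬ (localCompletion H x).Adj b c → False := by
    intro z a b c hab hac hbc hza hzb hxz hxc nab nac nbc
    simp only [localCompletion_adj] at *
    push Not at nab nac nbc
    have hxa : ¬ H.Adj x a := fun h => nac.2 hac h hxc
    have hxb : ¬ H.Adj x b := fun h => nbc.2 hbc h hxc
    have hax : x ≠ a := by rintro rfl; exact nac.1 hxc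
    have hbx : x ≠ b := by rintro rfl; exact nbc.1 hxc
    exact hclaw ⟨z, x, a, b, hax, hbx, hab, hxz.symm, hza.resolve_right fun h => hxa h.2.2,
      hzb.resolve_right fun h => hxb h.2.2, hxa, hxb, nab.1⟩
  rintro ⟨z, a, b, c, hab, hac, hbc, hza, hzb, hzc, nab, nac, nbc⟩
  rcases hza with hza' | ⟨-, h1, h2⟩
  · rcases hzb with hzb' | ⟨-, h1, h2⟩
    · rcases hzc with hzc' | ⟨-, h1, h2⟩
      · exact hclaw ⟨z, a, b, c, hab, hac, hbc, hza', hzb', hzc', fun h => nab (Or.inl h),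
          fun h => nac (Or.inl h), fun h => nbc (Or.inl h)⟩
      · exact key z a b c hab hac hbc (Or.inl hza') (Or.inl hzb') h1 h2 nab nac nbc
    · exact key z a c b hac hab hbc.symm (Or.inl hza') hzc h1 h2 nac nab fun h => nbc h.symm
  · exact key z b c a hbc hab.symm hac.symm hzb hzc h1 h2 nbc (fun h => nab h.symm)
      fun h => nac h.symm

/-- A chain in the local completion splits into chains of the original graph, with splits between
neighbours of `x`. -/
theorem exists_split_of_isChain_localCompletion (H : SimpleGraph V) (x : V) (l : List V)
    (hl : l ≠ []) (hch : l.IsChain (localCompletion H x).Adj)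
    (hlast : ∀ a ∈ l.getLast?, H.Adj x a) :
    ∃ P Ps, (P :: Ps).flatten = l ∧ P ≠ [] ∧ P.IsChain H.Adj ∧
      (∀ a ∈ P.getLast?, H.Adj x a) ∧ ∀ Q ∈ Ps, IsEndedChain H (H.neighborSet x) Q := by
  induction l with
  | nil => exact absurd rfl hl
  | cons a l ih =>
    rcases l with _ | ⟨b, l⟩
    · exact ⟨[a], [], by simp, by simp, by simp, by simpa using hlast, by simp⟩
    · rw [List.isChain_cons_cons] at hch
      rw [List.getLast?_cons_cons] at hlast
      obtain ⟨P, Ps, h1, h2, h3, h4, h5⟩ := ih (by simp) hch.2 hlast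
      rcases P with _ | ⟨b', P⟩
      · exact absurd rfl h2
      obtain rfl : b' = b := by simp at h1; exact h1.1
      rcases hch.1 with h | ⟨-, hxa, hxb⟩
      · exact ⟨a :: b' :: P, Ps, by simpa using h1, by simp, by simp [h, h3],
          by simpa [List.getLast?_cons_cons] using h4, h5⟩
      · refine ⟨[a], (b' :: P) :: Ps, by simpa using h1, by simp, by simp, by simpa using hxa, ?_⟩
        intro Q hQ
        rcases List.mem_cons.1 hQ with rfl | hQ
        · exact ⟨by simp, h3, by simpa using hxb, h4⟩
        · exact h5 Q hQ

variable [Fintype V] [DecidableEq V]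

theorem isHamiltonian_of_localCompletion {H : SimpleGraph V} (hclaw : ClawFree H)
    (hc : 3 ≤ Fintype.card V) {x : V}
    (hconn : ∀ X : Set V, (∃ a ∈ X, H.Adj x a) → (∃ b ∉ X, H.Adj x b) →
      ∃ a ∈ X, ∃ b ∉ X, H.Adj x a ∧ H.Adj x b ∧ H.Adj a b)
    (hham : (localCompletion H x).IsHamiltonian) : H.IsHamiltonian := by
  obtain ⟨l, hl⟩ := hham.exists_isHamiltonianList hc x
  have hadj : ∀ y, (localCompletion H x).Adj x y → H.Adj x y := by
    intro y hy
    simpa [localCompletion_adj] using hy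
  have hne : l ≠ [] := by
    rintro rfl
    obtain ⟨v, hv⟩ := Fintype.exists_ne_of_one_lt_card (by omega : 1 < Fintype.card V) x
    simpa [hv] using hl.mem v
  have hch := List.isChain_cons.1 hl.chain
  have hlast : ∀ a ∈ l.getLast?, H.Adj x a := by
    intro a ha
    refine hadj a (hl.closed a ?_ x (by simp)).symm
    rcases l with _ | ⟨b, l⟩
    · simp at ha
    · simpa [List.getLast?_cons_cons] using ha
  obtain ⟨P, Ps, h1, h2, h3, h4, h5⟩ :=
    exists_split_of_isChain_localCompletion H x l hne hch.2 hlast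
  refine IsChainCover.isHamiltonian hclaw hc hconn (P :: Ps) ⟨?_, ?_, ?_⟩
  · intro Q hQ
    rcases List.mem_cons.1 hQ with rfl | hQ
    · refine ⟨h2, h3, fun a ha => hadj a (hch.1 a ?_), h4⟩
      rw [← h1, List.flatten_cons, List.head?_append_of_ne_nil _ h2]
      exact ha
    · exact h5 Q hQ
  · rw [h1]
    exact (List.nodup_cons.1 hl.nodup).2
  · intro v
    rw [h1]
    have h6 := (List.nodup_cons.1 hl.nodup).1
    have h7 := List.mem_cons.1 (hl.mem v)
    exact ⟨fun h hv => h6 (hv ▸ h), fun h => h7.resolve_left h⟩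

/-- Two adjacent vertices have pairwise adjacent common neighbours. -/
def DiamondFree (H : SimpleGraph V) : Prop :=
  ∀ x v u w, H.Adj x v → H.Adj x u → H.Adj x w → H.Adj v u → H.Adj v w → u ≠ w → H.Adj u w

/-- A non-Hamiltonian claw-free graph lies in one without induced diamonds. -/
theorem ClawFree.exists_diamondFree_ge {G : SimpleGraph V} (hclaw : ClawFree G)
    (hc : 3 ≤ Fintype.card V) (hham : ¬ G.IsHamiltonian) :
    ∃ H, G ≤ H ∧ ClawFree H ∧ ¬ H.IsHamiltonian ∧ DiamondFree H := by
  obtain ⟨H, hGH, hmax⟩ :=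
    (Set.toFinite {H : SimpleGraph V | ClawFree H ∧ ¬ H.IsHamiltonian}).exists_le_maximal
    (a := G) ⟨hclaw, hham⟩
  refine ⟨H, hGH, hmax.prop.1, hmax.prop.2, ?_⟩
  have hcl : ClawFree H := hmax.prop.1
  intro x v u w hxv hxu hxw hvu hvw huw
  by_contra hn
  have hconn : ∀ X : Set V, (∃ a ∈ X, H.Adj x a) → (∃ b ∉ X, H.Adj x b) →
      ∃ a ∈ X, ∃ b ∉ X, H.Adj x a ∧ H.Adj x b ∧ H.Adj a b := by
    rintro X ⟨a, haX, hxa⟩ ⟨b, hbX, hxb⟩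
    by_contra! hX
    have hconst : ∀ a b, H.Adj x a → H.Adj x b → H.Adj a b → (a ∈ X ↔ b ∈ X) := by
      intro a b ha hb hab
      constructor
      · intro h
        by_contra h'
        exact hX a h b h' ha hb hab
      · intro h
        by_contra h'
        exact hX b h a h' hb ha hab.symm
    have hu := hconst v u hxv hxu hvu
    have hw := hconst v w hxv hxw hvw
    have hall : ∀ z, H.Adj x z → (z ∈ X ↔ v ∈ X) := by
      intro z hz
      by_cases h1 : u = z
      · rw [← h1, hu]
      by_cases h2 : w = z
      · rw [← h2, hw]
      by_cases h3 : H.Adj u z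
      · rw [hu, hconst u z hxu hz h3]
      by_cases h4 : H.Adj w z
      · rw [hw, hconst w z hxw hz h4]
      exact absurd ⟨x, u, w, z, huw, h1, h2, hxu, hxw, hz, hn, h3, h4⟩ hcl
    exact hbX ((hall b hxb).2 ((hall a hxa).1 haX))
  have hlt : ¬ localCompletion H x ≤ H := fun h => hn (h (Or.inr ⟨huw, hxu, hxw⟩))
  refine hlt (hmax.2 ⟨clawFree_localCompletion hcl x, ?_⟩ (le_localCompletion H x))
  exact fun h => hmax.prop.2 (isHamiltonian_of_localCompletion hcl hc hconn h)

end Closure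

section SpectralBounds

theorem mul_add_six_le_qIndex_EPgraph (k : ℕ) (hk : 3 ≤ k) :
    (k : ℝ) * (2 * k - 2) + 6 ≤ qIndex (EPgraph (k + 6)) * k := by
  classical
  have hcount : ∀ m ≤ k + 6, ∀ c : ℝ, ∑ u : Fin (k + 6), (if u.val < m then c else 0) = m * c := by
    intro m hm c
    rw [Finset.sum_ite, Finset.sum_const_zero, add_zero, Finset.sum_const, nsmul_eq_mul]
    congr 2
    rw [Fin.card_filter_val_lt]
    omega
  let x : Fin (k + 6) → ℝ := fun v => if v.val < k then 1 else 0
  have h := (signlessMul_spec (EPgraph (k + 6))).2.1 x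
  have hx2 : ∑ v, x v ^ 2 = k := by
    simp only [x, ite_pow, one_pow, zero_pow two_ne_zero]
    simpa using hcount k (by omega) 1
  rw [hx2] at h
  refine le_trans ?_ h
  have hv : ∀ v : Fin (k + 6), (if v.val < k then (2 * k - 2 : ℝ) else 0) +
      (if v.val < 3 then 2 else 0) ≤ x v * signlessMul (EPgraph (k + 6)) x v := by
    intro v
    by_cases hvk : v.val < k
    swap
    · have : ¬ v.val < 3 := by omega
      simp [hvk, this, x]
    simp only [x, hvk, if_true, one_mul, signlessMul]
    have hsum : ∑ u : Fin (k + 6), ((if u.val < k then (2 : ℝ) else 0) - (if u = v then 2 else 0) +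
        ((if v.val < 3 then (if u.val = v.val + k then 1 else 0) else 0) +
          (if v.val < 3 then (if u.val = v.val + k + 3 then 1 else 0) else 0))) =
        (2 * k - 2 : ℝ) + (if v.val < 3 then 2 else 0) := by
      rw [Finset.sum_add_distrib, Finset.sum_sub_distrib, Finset.sum_add_distrib,
        hcount k (by omega)]
      simp only [Finset.sum_ite_eq', Finset.mem_univ, if_true]
      by_cases hv3 : v.val < 3
      · simp only [hv3, if_true]
        have h1 : ∀ u : Fin (k + 6), u.val = v.val + k ↔ u = ⟨v.val + k, by omega⟩ := by
          simp [Fin.ext_iff]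
        have h2 : ∀ u : Fin (k + 6), u.val = v.val + k + 3 ↔ u = ⟨v.val + k + 3, by omega⟩ := by
          simp [Fin.ext_iff]
        simp only [h1, h2, Finset.sum_ite_eq', Finset.mem_univ, if_true]
        ring
      · simp [hv3]; ring
    rw [← hsum]
    refine Finset.sum_le_sum fun u _ => ?_
    by_cases huv : u = v
    · subst huv
      have h1 : k ≠ 0 := by omega
      have h2 : u.val ≠ u.val + k + 3 := by omega
      simp [hvk, h1, h2]
    have hne : v ≠ u := fun h => huv h.symm
    by_cases huk : u.val < k
    · have hadj : (EPgraph (k + 6)).Adj v u := by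
        simp only [EPgraph, SimpleGraph.fromRel_adj]
        exact ⟨hne, Or.inl (Or.inl ⟨by omega, by omega⟩)⟩
      have h1 : u.val ≠ v.val + k := by omega
      have h2 : u.val ≠ v.val + k + 3 := by omega
      simp [huk, hadj, huv, h1, h2]
      norm_num
    · by_cases h3 : v.val < 3 ∧ (u.val = v.val + k ∨ u.val = v.val + k + 3)
      · have hadj : (EPgraph (k + 6)).Adj v u := by
          simp only [EPgraph, SimpleGraph.fromRel_adj]
          exact ⟨hne, Or.inl (Or.inr (Or.inr (Or.inl ⟨h3.1, by omega⟩)))⟩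
        rcases h3 with ⟨h3, h4 | h4⟩
        · simp [hadj, huv, h3, h4]
        · have h5 : ¬ v.val + k + 3 < k := by omega
          simp [hadj, huv, h3, h4, h5]
      · have h4 : (0 : ℝ) ≤ if (EPgraph (k + 6)).Adj v u then
            (1 : ℝ) + (if u.val < k then 1 else 0) else 0 := by
          split_ifs <;> norm_num
        refine le_trans (le_of_eq ?_) h4
        by_cases h5 : v.val < 3
        · have h6 : u.val ≠ v.val + k := by omega
          have h7 : u.val ≠ v.val + k + 3 := by omega
          simp [huk, huv, h6, h7]
        · simp [huk, huv, h5]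
  refine le_trans (le_of_eq ?_) (Finset.sum_le_sum fun v _ => hv v)
  rw [Finset.sum_add_distrib, hcount k (by omega), hcount 3 (by omega)]
  norm_num

variable {V : Type*} [Fintype V] [DecidableEq V]

theorem qIndex_mul_le_of_two_attachments [Nonempty V] {H : SimpleGraph V} {k : ℕ} (hk : 45 ≤ k)
    (hcard : Fintype.card V = k + 6) {K : Finset V} (hK : K.card = k) {x x' : V} (hxK : x ∈ K)
    (hxK' : x' ∈ K) (hne : x ≠ x')
    (hfree : ∀ v ∈ K, v ≠ x → v ≠ x' → ∀ r ∉ K, ¬ H.Adj v r)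
    (htwo : ∀ v ∈ K, {r | r ∉ K ∧ H.Adj v r}.ncard ≤ 2)
    (hone : ∀ r ∉ K, ∀ a ∈ K, ∀ b ∈ K, H.Adj r a → H.Adj r b → a = b) :
    qIndex H * k ≤ k * (2 * k - 2) + 5 := by
  classical
  have hk0 : (45 : ℝ) ≤ k := by exact_mod_cast hk
  obtain ⟨s, hs⟩ : ∃ s : ℝ, s * k = 5 / 2 := ⟨5 / (2 * k), by field_simp⟩
  have hs0 : 0 < s := by
    by_contra! h
    nlinarith
  have hs1 : s ≤ 1 / 18 := by nlinarith
  let z : V → ℝ := fun v =>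
    if v ∈ K then 1 + ((if v = x then s else 0) + if v = x' then s else 0) else 1 / 8
  have hz : ∀ v, 0 < z v := by
    intro v
    simp only [z]
    split_ifs <;> linarith
  have hzR : ∀ v ∉ K, z v = 1 / 8 := fun v hv => by simp [z, hv]
  have hzle : ∀ v, z v ≤ 1 + s := by
    intro v
    simp only [z]
    split_ifs with h1 h2 h3 h3
    · exact absurd (h2.symm.trans h3) hne
    all_goals linarith
  have hsumK : ∑ u ∈ K, z u = k + 2 * s := by
    have : ∑ u ∈ K, z u = ∑ u ∈ K, (1 + ((if u = x then s else 0) + if u = x' then s else 0)) :=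
      Finset.sum_congr rfl fun u hu => by simp [z, hu]
    rw [this, Finset.sum_add_distrib, Finset.sum_add_distrib]
    simp [hxK, hxK', hK]
    ring
  obtain ⟨v, hv⟩ := exists_qIndex_mul_le H z hz
  let NK := Finset.univ.filter fun u => H.Adj v u ∧ u ∈ K
  let NR := Finset.univ.filter fun u => H.Adj v u ∧ u ∉ K
  have hsplit : signlessMul H z v = ∑ u ∈ NK, (z v + z u) + NR.card * (z v + 1 / 8) := by
    have h1 : ∑ u ∈ NR, (z v + z u) = NR.card * (z v + 1 / 8) := by
      rw [← nsmul_eq_mul, ← Finset.sum_const]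
      refine Finset.sum_congr rfl fun u hu => ?_
      rw [hzR u (by simp [NR] at hu; exact hu.2)]
    rw [← h1, Finset.sum_filter, Finset.sum_filter, ← Finset.sum_add_distrib, signlessMul]
    refine Finset.sum_congr rfl fun u _ => ?_
    by_cases h1 : H.Adj v u <;> by_cases h2 : u ∈ K <;> simp [h1, h2]
  by_cases hvK : v ∈ K
  · have hNK : ∑ u ∈ NK, (z v + z u) ≤ (k - 2) * z v + k + 2 * s := by
      have h1 : ∑ u ∈ NK, (z v + z u) ≤ ∑ u ∈ K.erase v, (z v + z u) := by
        refine Finset.sum_le_sum_of_subset_of_nonneg ?_ fun u _ _ => (add_pos (hz v) (hz u)).le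
        intro u hu
        simp only [NK, Finset.mem_filter, Finset.mem_univ, true_and] at hu
        exact Finset.mem_erase.2 ⟨hu.1.ne', hu.2⟩
      have h2 := Finset.add_sum_erase K (fun u => z v + z u) hvK
      simp only [Finset.sum_add_distrib, Finset.sum_const, nsmul_eq_mul, hK, hsumK] at h2
      simp only [Finset.sum_add_distrib, Finset.sum_const, nsmul_eq_mul] at h1
      simp only [Finset.sum_add_distrib, Finset.sum_const, nsmul_eq_mul]
      linarith
    by_cases hvx : v = x ∨ v = x'
    · have hzv : z v = 1 + s := by
        simp only [z, hvK, if_true]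
        rcases hvx with rfl | rfl
        · simp [hne]
        · simp [hne.symm]
      have hNR : (NR.card : ℝ) ≤ 2 := by
        have := htwo v hvK
        rw [Set.ncard_eq_toFinset_card'] at this
        exact_mod_cast le_trans (Finset.card_le_card fun u hu => by
          simp only [NR, Finset.mem_filter, Finset.mem_univ, true_and] at hu
          simpa using hu.symm) this
      rw [hzv] at hNK hsplit hv
      nlinarith
    · push Not at hvx
      have hzv : z v = 1 := by simp [z, hvK, hvx.1, hvx.2]
      have hNR : NR.card = 0 := by
        rw [Finset.card_eq_zero, Finset.filter_eq_empty_iff]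
        exact fun u _ h => hfree v hvK hvx.1 hvx.2 u h.2 h.1
      rw [hzv] at hNK hsplit hv
      rw [hNR] at hsplit
      push_cast at hsplit
      nlinarith
  · have hzv := hzR v hvK
    have hNKcard : (NK.card : ℝ) ≤ 1 := by
      have : NK.card ≤ 1 := Finset.card_le_one.2 fun a ha b hb => by
        simp only [NK, Finset.mem_filter, Finset.mem_univ, true_and] at ha hb
        exact hone v hvK a ha.2 b hb.2 ha.1 hb.1
      exact_mod_cast this
    have hNK : ∑ u ∈ NK, (z v + z u) ≤ NK.card * (z v + (1 + s)) := by
      rw [← nsmul_eq_mul, ← Finset.sum_const]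
      exact Finset.sum_le_sum fun u _ => by linarith [hzle u]
    have hNR : (NR.card : ℝ) ≤ 6 := by
      have : NR.card ≤ Kᶜ.card := Finset.card_le_card fun u hu => by
        simp only [NR, Finset.mem_filter, Finset.mem_univ, true_and] at hu
        simpa using hu.2
      rw [Finset.card_compl, hcard, hK] at this
      exact_mod_cast this.trans (by omega)
    rw [hzv] at hNK hsplit hv
    nlinarith

end SpectralBounds

section LargeClique

variable {V : Type*} [DecidableEq V]

theorem eq_of_adj_of_maximum_clique {H : SimpleGraph V} (hdia : DiamondFree H) {K : Finset V}
    (hK : H.IsClique K) (hmax : ∀ K' : Finset V, H.IsClique K' → K'.card ≤ K.card) {r : V}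
    (hr : r ∉ K) {a b : V} (ha : a ∈ K) (hb : b ∈ K) (hra : H.Adj r a) (hrb : H.Adj r b) :
    a = b := by
  by_contra hab
  have : H.IsClique (insert r K : Finset V) := by
    rw [Finset.coe_insert, SimpleGraph.isClique_insert]
    refine ⟨hK, fun c hc hrc => ?_⟩
    by_cases hca : c = a
    · rwa [hca]
    by_cases hcb : c = b
    · rwa [hcb]
    exact hdia a b r c (hK ha hb hab) hra.symm (hK ha hc (Ne.symm hca)) hrb.symm
      (hK hb hc (Ne.symm hcb)) hrc
  have := hmax _ this
  rw [Finset.card_insert_of_notMem hr] at this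
  omega

variable [Fintype V]

theorem exists_clique_of_degree {H : SimpleGraph V} [DecidableRel H.Adj] (hclaw : ClawFree H)
    (hdia : DiamondFree H) {v u : V} (huv : H.Adj v u) :
    ∃ K : Finset V, H.IsClique K ∧ H.degree v + 2 ≤ 2 * K.card := by
  let N := H.neighborFinset v
  let A := N.filter fun w => w = u ∨ H.Adj u w
  let B := N.filter fun w => ¬ (w = u ∨ H.Adj u w)
  have hAB : A.card + B.card = H.degree v := Finset.card_filter_add_card_filter_not _
  have hA : H.IsClique (insert v A : Finset V) := by
    intro a ha b hb hab
    simp only [Finset.coe_insert, Set.mem_insert_iff, Finset.mem_coe, A, N, Finset.mem_filter,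
      SimpleGraph.mem_neighborFinset] at ha hb
    rcases ha with rfl | ⟨ha, ha'⟩ <;> rcases hb with rfl | ⟨hb, hb'⟩
    · exact absurd rfl hab
    · exact hb
    · exact ha.symm
    · rcases ha' with rfl | ha' <;> rcases hb' with rfl | hb'
      · exact absurd rfl hab
      · exact hb'
      · exact ha'.symm
      · exact hdia v u a b huv ha hb ha' hb' hab
  have hB : H.IsClique (insert v B : Finset V) := by
    intro a ha b hb hab
    simp only [Finset.coe_insert, Set.mem_insert_iff, Finset.mem_coe, B, N, Finset.mem_filter,
      SimpleGraph.mem_neighborFinset, not_or] at ha hb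
    rcases ha with rfl | ⟨ha, ha1, ha2⟩ <;> rcases hb with rfl | ⟨hb, hb1, hb2⟩
    · exact absurd rfl hab
    · exact hb
    · exact ha.symm
    · by_contra hn
      exact hclaw ⟨v, u, a, b, Ne.symm ha1, Ne.symm hb1, hab, huv, ha, hb, ha2, hb2, hn⟩
  have hvA : v ∉ A := by simp [A, N]
  have hvB : v ∉ B := by simp [B, N]
  by_cases h : B.card ≤ A.card
  · exact ⟨_, hA, by rw [Finset.card_insert_of_notMem hvA]; omega⟩
  · exact ⟨_, hB, by rw [Finset.card_insert_of_notMem hvB]; omega⟩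

theorem sum_degree_le_of_clique {H : SimpleGraph V} [DecidableRel H.Adj] {K : Finset V}
    (hone : ∀ r ∉ K, ∀ a ∈ K, ∀ b ∈ K, H.Adj r a → H.Adj r b → a = b) :
    ∑ v, H.degree v + K.card ≤ K.card * K.card + Kᶜ.card * (Kᶜ.card + 1) := by
  let f : V → V → ℕ := fun v u => if H.Adj v u then 1 else 0
  have hdeg : ∀ v, H.degree v = ∑ u ∈ K, f v u + ∑ u ∈ Kᶜ, f v u := by
    intro v
    rw [Finset.sum_add_sum_compl, ← SimpleGraph.card_neighborFinset_eq_degree,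
      SimpleGraph.neighborFinset_eq_filter, Finset.card_filter]
  have hin : ∀ S : Finset V, ∀ v ∈ S, ∑ u ∈ S, f v u + 1 ≤ S.card := by
    intro S v hv
    rw [← Finset.add_sum_erase S _ hv, ← Finset.card_erase_add_one hv]
    have : ∑ u ∈ S.erase v, f v u ≤ ∑ u ∈ S.erase v, 1 :=
      Finset.sum_le_sum fun u _ => by simp only [f]; split_ifs <;> omega
    simp only [Finset.sum_const, smul_eq_mul, mul_one] at this
    simp only [f, SimpleGraph.irrefl, if_false, zero_add] at this ⊢
    omega
  have hinS : ∀ S : Finset V, ∑ v ∈ S, ∑ u ∈ S, f v u + S.card ≤ S.card * S.card := by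
    intro S
    have := Finset.sum_le_sum (hin S)
    simpa [Finset.sum_add_distrib] using this
  have hR : ∀ r ∈ Kᶜ, ∑ u ∈ K, f r u ≤ 1 := by
    intro r hr
    rw [Finset.mem_compl] at hr
    simp only [f]
    rw [← Finset.card_filter]
    refine Finset.card_le_one.2 fun a ha b hb => ?_
    rw [Finset.mem_filter] at ha hb
    exact hone r hr a ha.1 b hb.1 ha.2 hb.2
  have hRK : ∑ r ∈ Kᶜ, ∑ u ∈ K, f r u ≤ Kᶜ.card := by
    simpa using Finset.sum_le_sum hR
  have hKR : ∑ r ∈ K, ∑ u ∈ Kᶜ, f r u = ∑ r ∈ Kᶜ, ∑ u ∈ K, f r u := by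
    rw [Finset.sum_comm]
    simp only [f, H.adj_comm]
  have h1 := hinS K
  have h2 := hinS Kᶜ
  rw [← Finset.sum_add_sum_compl K]
  simp only [hdeg, Finset.sum_add_distrib]
  rw [hKR]
  nlinarith

/-- A claw-free graph without induced diamonds and with large `Q`-index is a clique up to at most
six vertices. -/
theorem exists_large_clique {H : SimpleGraph V} (hclaw : ClawFree H) (hdia : DiamondFree H)
    {n : ℕ} (hn : 51 ≤ n) (hcard : Fintype.card V = n) (hdeg : ∀ v, ∃ u, H.Adj v u)
    (hq : (2 * (n - 7) : ℝ) ≤ qIndex H) :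
    ∃ K : Finset V, H.IsClique K ∧ Kᶜ.card ≤ 6 ∧
      ∀ r ∉ K, ∀ a ∈ K, ∀ b ∈ K, H.Adj r a → H.Adj r b → a = b := by
  classical
  have : Nonempty V := Fintype.card_pos_iff.1 (by omega)
  have hn' : (51 : ℝ) ≤ n := by exact_mod_cast hn
  have hpos : ∀ v, 1 ≤ H.degree v := by
    intro v
    obtain ⟨u, hu⟩ := hdeg v
    exact (H.degree_pos_iff_exists_adj v).2 ⟨u, hu⟩
  have hlt : ∀ v, H.degree v + 1 ≤ n := fun v => hcard ▸ H.degree_lt_card_verts v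
  obtain ⟨v, hv⟩ := exists_qIndex_mul_le H (fun v => (H.degree v : ℝ))
    fun v => by exact_mod_cast hpos v
  have hS : signlessMul H (fun v => (H.degree v : ℝ)) v =
      (H.degree v : ℝ) ^ 2 + ∑ u ∈ H.neighborFinset v, (H.degree u : ℝ) := by
    rw [signlessMul, ← Finset.sum_filter]
    rw [Finset.sum_add_distrib, Finset.sum_const, nsmul_eq_mul,
      SimpleGraph.neighborFinset_eq_filter, pow_two, ← SimpleGraph.card_neighborFinset_eq_degree,
      SimpleGraph.neighborFinset_eq_filter]
  rw [hS] at hv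
  have hd1 : (1 : ℝ) ≤ H.degree v := by exact_mod_cast hpos v
  have hd2 : (H.degree v : ℝ) ≤ n - 1 := by
    have : (H.degree v : ℝ) + 1 ≤ n := by exact_mod_cast hlt v
    linarith
  have hS1 : ∑ u ∈ H.neighborFinset v, (H.degree u : ℝ) ≤ H.degree v * (n - 1) := by
    rw [← SimpleGraph.card_neighborFinset_eq_degree, ← nsmul_eq_mul, ← Finset.sum_const]
    refine Finset.sum_le_sum fun u _ => ?_
    have : (H.degree u : ℝ) + 1 ≤ n := by exact_mod_cast hlt u
    linarith
  have hd3 : (n - 13 : ℝ) ≤ H.degree v := by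
    by_contra! h
    nlinarith
  have hS2 : ∑ u ∈ H.neighborFinset v, (H.degree u : ℝ) + (n - 1) ≤ ∑ u, (H.degree u : ℝ) := by
    have h1 : v ∉ H.neighborFinset v := by simp
    rw [← Finset.sum_add_sum_compl (insert v (H.neighborFinset v)), Finset.sum_insert h1]
    have h2 : ((insert v (H.neighborFinset v))ᶜ.card : ℝ) ≤
        ∑ u ∈ (insert v (H.neighborFinset v))ᶜ, (H.degree u : ℝ) := by
      rw [← nsmul_one, ← Finset.sum_const]
      exact Finset.sum_le_sum fun u _ => by exact_mod_cast hpos u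
    have h3 : ((insert v (H.neighborFinset v))ᶜ.card : ℝ) + (H.degree v + 1) = n := by
      have := Finset.card_add_card_compl (insert v (H.neighborFinset v))
      rw [Finset.card_insert_of_notMem h1, SimpleGraph.card_neighborFinset_eq_degree, hcard] at this
      exact_mod_cast (by omega : _ + (H.degree v + 1) = n)
    linarith
  have hD : (n - 1 : ℝ) * (n - 12) ≤ ∑ u, (H.degree u : ℝ) := by nlinarith
  obtain ⟨u, hu⟩ := hdeg v
  obtain ⟨K₀, hK₀, hK₀'⟩ := exists_clique_of_degree hclaw hdia hu
  obtain ⟨K, hK, hmax⟩ := Finset.exists_max_image (Finset.univ.filter fun K : Finset V =>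
    H.IsClique (K : Set V)) Finset.card ⟨K₀, by simpa using hK₀⟩
  simp only [Finset.mem_filter, Finset.mem_univ, true_and] at hK hmax
  have hone : ∀ r ∉ K, ∀ a ∈ K, ∀ b ∈ K, H.Adj r a → H.Adj r b → a = b :=
    fun r hr a ha b hb => eq_of_adj_of_maximum_clique hdia hK hmax hr ha hb
  refine ⟨K, hK, ?_, hone⟩
  have h1 := sum_degree_le_of_clique hone
  have h2 : (n : ℝ) ≤ H.degree v + 13 := by linarith
  have h3 : n ≤ H.degree v + 13 := by exact_mod_cast h2
  have h4 := hmax K₀ hK₀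
  have h5 := Finset.card_add_card_compl K
  rw [hcard] at h5
  by_contra! h6
  obtain ⟨r, hr⟩ : ∃ r, Kᶜ.card = r + 7 := ⟨Kᶜ.card - 7, by omega⟩
  obtain ⟨k, hk⟩ : ∃ k, K.card = k + 8 := ⟨K.card - 8, by omega⟩
  rw [hr, hk] at h1 h5
  have h7 : (∑ v, (H.degree v : ℝ)) + (k + 8) ≤ (k + 8) * (k + 8) + (r + 7) * (r + 7 + 1) := by
    exact_mod_cast h1
  have h8 : (k + 8 + (r + 7) : ℝ) = n := by exact_mod_cast h5
  rw [← h8] at hD hn'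
  have hr0 : (0 : ℝ) ≤ r := Nat.cast_nonneg r
  have hk0 : (0 : ℝ) ≤ k := Nat.cast_nonneg k
  nlinarith [mul_nonneg hr0 hk0]

end LargeClique

section CliqueCores

variable {V : Type*} [Fintype V] [DecidableEq V]

/-- A vertex set missing at least two vertices contains a path whose ends are joined to distinct
outside vertices. -/
theorem TwoConnected.exists_ear {H : SimpleGraph V} (h2 : TwoConnected H) {U : Set V} {w : V}
    (hw : w ∈ U) {s t : V} (hs : s ∉ U) (ht : t ∉ U) (hst : s ≠ t) :
    ∃ u v ws, u ∉ U ∧ v ∉ U ∧ u ≠ v ∧ ws ≠ [] ∧ ws.Nodup ∧ (∀ x ∈ ws, x ∈ U) ∧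
      (u :: ws ++ [v]).IsChain H.Adj := by
  have hexit : ∀ t ∉ U, ∃ x : U, (H.induce U).Reachable ⟨w, hw⟩ x ∧
      ∃ u ∉ U, u ≠ t ∧ H.Adj x u := by
    intro t' ht'
    obtain ⟨z, hzU, hzt⟩ : ∃ z ∉ U, z ≠ t' := by
      by_cases h : s = t'
      · exact ⟨t, ht, fun h' => hst (h.trans h'.symm)⟩
      · exact ⟨s, hs, h⟩
    have hwt : w ≠ t' := fun h => ht' (h ▸ hw)
    obtain ⟨p⟩ := (h2.2 t').preconnected ⟨w, hwt⟩ ⟨z, hzt⟩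
    obtain ⟨d, -, ⟨hd1, hd2⟩, hd3⟩ := p.exists_boundary_dart
      {x | ∃ hx : x.1 ∈ U, (H.induce U).Reachable ⟨w, hw⟩ ⟨x.1, hx⟩} ⟨hw, .refl _⟩
      fun h => hzU h.1
    have hadj : H.Adj d.fst.1 d.snd.1 := d.adj
    refine ⟨⟨d.fst.1, hd1⟩, hd2, d.snd.1, fun h => hd3 ⟨h, hd2.trans ?_⟩, d.snd.2, hadj⟩
    exact SimpleGraph.Adj.reachable hadj
  obtain ⟨x, hx, u, huU, -, hxu⟩ := hexit s hs
  obtain ⟨y, hy, v, hvU, hvu, hyv⟩ := hexit u huU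
  obtain ⟨p, hp⟩ := (hx.symm.trans hy).exists_isPath
  have hne : p.support.map Subtype.val ≠ [] := fun h => p.support_ne_nil (List.map_eq_nil_iff.1 h)
  refine ⟨u, v, p.support.map Subtype.val, huU, hvU, hvu.symm, hne, ?_, ?_, ?_⟩
  · exact hp.support_nodup.map Subtype.val_injective
  · intro z hz
    obtain ⟨z', -, rfl⟩ := List.mem_map.1 hz
    exact z'.2
  · have hhead : p.support.head? = some x := by
      rw [List.head?_eq_some_head p.support_ne_nil, p.head_support]
    have hlast : p.support.getLast? = some y := by
      rw [List.getLast?_eq_some_getLast p.support_ne_nil, p.getLast_support]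
    rw [List.cons_append, List.isChain_cons, List.head?_append_of_ne_nil _ hne, List.head?_map,
      hhead, List.isChain_append, List.getLast?_map, hlast]
    refine ⟨by simpa using hxu.symm, ?_, by simp, by simpa using hyv⟩
    exact List.isChain_map_of_isChain Subtype.val (fun _ _ h => h) p.isChain_adj_support

/-- A non-Hamiltonian claw-free graph with a clique covering all but at most six vertices, each of
which has at most one neighbour in the clique. -/
structure IsCliqueCore (H : SimpleGraph V) (K : Finset V) : Prop where
  claw : ClawFree H
  clique : H.IsClique K
  uniq : ∀ r ∉ K, ∀ a ∈ K, ∀ b ∈ K, H.Adj r a → H.Adj r b → a = b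
  two_le : 2 ≤ K.card
  card : 3 ≤ Fintype.card V
  small : Kᶜ.card ≤ 6
  nonham : ¬ H.IsHamiltonian

namespace IsCliqueCore

variable {H : SimpleGraph V} {K : Finset V} (h : IsCliqueCore H K)
include h

theorem adj_of_common {x r s : V} (hx : x ∈ K) (hr : r ∉ K) (hs : s ∉ K) (hrs : r ≠ s)
    (hxr : H.Adj x r) (hxs : H.Adj x s) : H.Adj r s := by
  by_contra hn
  obtain ⟨c, hc, hcx⟩ := K.exists_mem_ne (by have := h.two_le; omega) x
  refine h.claw ⟨x, r, s, c, hrs, ?_, ?_, hxr, hxs, h.clique hx hc hcx.symm, hn, ?_, ?_⟩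
  · rintro rfl; exact hr hc
  · rintro rfl; exact hs hc
  · exact fun hrc => hcx (h.uniq r hr c hc x hx hrc hxr.symm)
  · exact fun hsc => hcx (h.uniq s hs c hc x hx hsc hxs.symm)

theorem length_le {l : List V} (hnd : l.Nodup) (hl : ∀ v ∈ l, v ∉ K) : l.length ≤ 6 := by
  rw [← List.toFinset_card_of_nodup hnd]
  exact (Finset.card_le_card fun v hv => by simpa using hl v (by simpa using hv)).trans h.small

theorem mem_of_length {l : List V} (hnd : l.Nodup) (hl : ∀ v ∈ l, v ∉ K) (h6 : 6 ≤ l.length)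
    {r : V} (hr : r ∉ K) : r ∈ l := by
  by_contra hrl
  have := h.length_le (List.nodup_cons.2 ⟨hrl, hnd⟩) (by simpa using ⟨hr, hl⟩)
  simp at this
  omega

theorem flatten_isEndedChain {Ps : List (List V)} (hne : Ps ≠ [])
    (hPs : ∀ P ∈ Ps, IsEndedChain H K P) (hnd : Ps.flatten.Nodup) :
    IsEndedChain H K Ps.flatten := by
  induction Ps with
  | nil => exact absurd rfl hne
  | cons P Ps ih =>
    by_cases hPs' : Ps = []
    · subst hPs'
      simpa using hPs P (by simp)
    have hP := hPs P (by simp)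
    rw [List.flatten_cons, List.nodup_append] at hnd
    have ih' := ih hPs' (fun Q hQ => hPs Q (by simp [hQ])) hnd.2.1
    refine hP.append ih' fun a ha b hb => h.clique (hP.last a ha) (ih'.head b hb) ?_
    exact hnd.2.2 a (List.mem_of_mem_getLast? ha) b (List.mem_of_mem_head? hb)

/-- The vertices outside the clique cannot be covered by disjoint chains ending in the clique. -/
theorem false_of_cover {Ps : List (List V)} (hPs : ∀ P ∈ Ps, IsEndedChain H K P)
    (hnd : Ps.flatten.Nodup) (hcov : ∀ r ∉ K, r ∈ Ps.flatten) : False := by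
  let Qs := Ps ++ (K.toList.filter (· ∉ Ps.flatten)).map fun v => [v]
  have hQs : Qs.flatten = Ps.flatten ++ K.toList.filter (· ∉ Ps.flatten) := by
    have hsing : ∀ l : List V, (l.map fun v => [v]).flatten = l := by
      intro l
      induction l with
      | nil => rfl
      | cons a l ih => simp [ih]
    rw [List.flatten_append, hsing]
  have hmem : ∀ v, v ∈ Qs.flatten := by
    intro v
    rw [hQs, List.mem_append, List.mem_filter]
    by_cases hv : v ∈ K
    · by_cases hv' : v ∈ Ps.flatten
      · exact Or.inl hv'
      · exact Or.inr ⟨by simpa using hv, by simpa using hv'⟩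
    · exact Or.inl (hcov v hv)
  have hQnd : Qs.flatten.Nodup := by
    rw [hQs, List.nodup_append]
    refine ⟨hnd, K.nodup_toList.filter _, ?_⟩
    rintro a ha b hb rfl
    rw [List.mem_filter] at hb
    simpa [ha] using hb.2
  have hlen : Qs.flatten.length = Fintype.card V := by
    rw [← List.toFinset_card_of_nodup hQnd, ← Finset.card_univ]
    congr 1
    exact Finset.eq_univ_iff_forall.2 fun v => List.mem_toFinset.2 (hmem v)
  have hend : IsEndedChain H K Qs.flatten := by
    refine h.flatten_isEndedChain ?_ ?_ hQnd
    · intro h0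
      rw [h0] at hlen
      have := h.card
      simp at hlen
      omega
    · intro P hP
      rcases List.mem_append.1 hP with hP | hP
      · exact hPs P hP
      · obtain ⟨v, hv, rfl⟩ := List.mem_map.1 hP
        rw [List.mem_filter] at hv
        have hvK : v ∈ K := by simpa using hv.1
        exact ⟨by simp, by simp, by simpa using hvK, by simpa using hvK⟩
  refine h.nonham (IsHamiltonianList.isHamiltonian ⟨hQnd, hmem, hend.chain, ?_⟩ h.card)
  intro a ha b hb
  refine h.clique (hend.last a ha) (hend.head b hb) ?_
  rintro rfl
  have h3 := h.card
  rw [← hlen] at h3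
  generalize Qs.flatten = F at *
  rcases F with _ | ⟨c, _ | ⟨d, F⟩⟩
  · simp at h3
  · simp at h3
  · simp at hb
    subst hb
    rw [List.getLast?_cons_cons] at ha
    exact (List.nodup_cons.1 hQnd).1 (List.mem_of_mem_getLast? ha)

end IsCliqueCore

end CliqueCores

section Segments

variable {V : Type*} [Fintype V] [DecidableEq V]

/-- A chain `a, ys, a'` with ends in `K` and a nonempty interior outside `K`. -/
structure IsSegment (H : SimpleGraph V) (K : Finset V) (a : V) (ys : List V) (a' : V) : Prop where
  left : a ∈ K
  right : a' ∈ K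
  ne_nil : ys ≠ []
  interior : ∀ y ∈ ys, y ∉ K
  chain : (a :: (ys ++ [a'])).IsChain H.Adj

/-- Disjoint segments. -/
structure IsSegmentSystem (H : SimpleGraph V) (K : Finset V) (Ls : List (List V)) : Prop where
  segment : ∀ L ∈ Ls, ∃ a ys a', L = a :: (ys ++ [a']) ∧ IsSegment H K a ys a'
  nodup : Ls.flatten.Nodup

/-- Disjoint segments covering as many vertices outside `K` as possible. -/
structure IsMaxSystem (H : SimpleGraph V) (K : Finset V) (Ls : List (List V)) : Prop
    extends IsSegmentSystem H K Ls where
  max : ∀ Ls', IsSegmentSystem H K Ls' →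
    Ls'.flatten.countP (· ∉ K) ≤ Ls.flatten.countP (· ∉ K)

variable {H : SimpleGraph V} {K : Finset V}

theorem IsSegment.isEndedChain {a a' : V} {ys : List V} (h : IsSegment H K a ys a') :
    IsEndedChain H K (a :: (ys ++ [a'])) := by
  refine ⟨by simp, h.chain, by simpa using h.left, ?_⟩
  rw [← List.cons_append, List.getLast?_append]
  simpa using h.right

theorem IsSegment.reverse {a a' : V} {ys : List V} (h : IsSegment H K a ys a') :
    IsSegment H K a' ys.reverse a := by
  refine ⟨h.right, h.left, by simpa using h.ne_nil, by simpa using h.interior, ?_⟩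
  have := h.chain
  rw [← List.isChain_reverse] at this
  simpa [H.adj_comm] using this

theorem IsCliqueCore.exists_isMaxSystem (h : IsCliqueCore H K) : ∃ Ls, IsMaxSystem H K Ls := by
  have hbound : ∀ Ls, IsSegmentSystem H K Ls → Ls.flatten.countP (· ∉ K) ≤ 6 := by
    intro Ls hLs
    rw [List.countP_eq_length_filter]
    exact h.length_le (hLs.nodup.filter _) fun v hv => by
      rw [List.mem_filter] at hv
      simpa using hv.2
  let P : ℕ → Prop := fun m => ∃ Ls, IsSegmentSystem H K Ls ∧ Ls.flatten.countP (· ∉ K) = m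
  classical
  have h0 : P 0 := ⟨[], ⟨by simp, by simp⟩, by simp⟩
  obtain ⟨Ls, hLs, hm⟩ := Nat.findGreatest_spec (P := P) (Nat.zero_le 6) h0
  refine ⟨Ls, hLs, fun Ls' hLs' => ?_⟩
  rw [hm]
  exact Nat.le_findGreatest (hbound Ls' hLs') ⟨Ls', hLs', rfl⟩

namespace IsMaxSystem

variable {Ls : List (List V)} (hmax : IsMaxSystem H K Ls)
include hmax

theorem false_of_replace {Ss Rest : List (List V)} {a a' : V} {ys X D : List V}
    (hp : Ls.Perm (Ss ++ Rest)) (hT : IsSegment H K a ys a') (hX : X.Nodup)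
    (hXL : ∀ x ∈ X, x ∉ Ls.flatten) (hXK : ∃ x ∈ X, x ∉ K)
    (hTD : ((a :: (ys ++ [a'])) ++ D).Perm (Ss.flatten ++ X)) (hD : ∀ d ∈ D, d ∈ K) : False := by
  have hperm : (((a :: (ys ++ [a'])) :: Rest).flatten ++ D).Perm (Ls.flatten ++ X) := by
    have h1 := hp.flatten
    rw [List.flatten_append] at h1
    rw [List.flatten_cons]
    have h2 : ((a :: (ys ++ [a'])) ++ D ++ Rest.flatten).Perm (Ss.flatten ++ X ++ Rest.flatten) :=
      hTD.append_right _
    refine List.Perm.trans ?_ (h2.trans ?_)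
    · rw [List.append_assoc, List.append_assoc]
      exact List.perm_append_comm.append_left _
    · refine List.Perm.trans ?_ (h1.append_right X).symm
      rw [List.append_assoc, List.append_assoc]
      exact List.perm_append_comm.append_left _
  have hnd : (((a :: (ys ++ [a'])) :: Rest).flatten ++ D).Nodup := by
    rw [hperm.nodup_iff, List.nodup_append]
    exact ⟨hmax.nodup, hX, fun u hu v hv huv => hXL v hv (huv ▸ hu)⟩
  have hsys : IsSegmentSystem H K ((a :: (ys ++ [a'])) :: Rest) := by
    refine ⟨?_, (List.nodup_append.1 hnd).1⟩
    intro L hL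
    rcases List.mem_cons.1 hL with rfl | hL
    · exact ⟨a, ys, a', rfl, hT⟩
    · exact hmax.segment L (hp.mem_iff.2 (by simp [hL]))
  have h1 := hmax.max _ hsys
  have h2 := hperm.countP_eq (· ∉ K)
  rw [List.countP_append, List.countP_append] at h2
  have h3 : D.countP (· ∉ K) = 0 := by
    rw [List.countP_eq_zero]
    simpa using hD
  have h4 : 0 < X.countP (· ∉ K) := by
    rw [List.countP_pos_iff]
    simpa using hXK
  omega

theorem false_of_new {a a' : V} {ys : List V} (hT : IsSegment H K a ys a')
    (hnd : (a :: (ys ++ [a'])).Nodup) (hL : ∀ x ∈ a :: (ys ++ [a']), x ∉ Ls.flatten) : False := by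
  obtain ⟨y, hy⟩ := List.exists_mem_of_ne_nil ys hT.ne_nil
  exact hmax.false_of_replace (Ss := []) (Rest := Ls) (D := []) (by simp) hT hnd hL
    ⟨y, by simp [hy], hT.interior y hy⟩ (by simp) (by simp)

theorem isSegment {Rest : List (List V)} {a a' : V} {ys : List V}
    (hp : Ls.Perm ((a :: (ys ++ [a'])) :: Rest)) : IsSegment H K a ys a' := by
  obtain ⟨b, zs, b', h1, h2⟩ := hmax.segment _ (hp.mem_iff.2 List.mem_cons_self)
  have h3 := List.cons.inj h1
  have h4 := List.append_inj' h3.2 rfl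
  obtain ⟨rfl, -⟩ := h3
  obtain ⟨rfl, h5⟩ := h4
  obtain rfl : a' = b' := by simpa using h5
  exact h2

/-- Replacing a segment by one containing the same vertices outside `K` and more. -/
theorem false_of_better {Rest : List (List V)} {a a' b b' : V} {ys zs X D : List V}
    (hp : Ls.Perm ((a :: (ys ++ [a'])) :: Rest))
    (hb : b ∈ K) (hb' : b' ∈ K) (hchain : (b :: (zs ++ [b'])).IsChain H.Adj) (hX : X.Nodup)
    (hXL : ∀ x ∈ X, x ∉ Ls.flatten) (hXK : ∃ x ∈ X, x ∉ K)
    (hTD : ((b :: (zs ++ [b'])) ++ D).Perm ((a :: (ys ++ [a'])) ++ X)) (hD : ∀ d ∈ D, d ∈ K)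
    (hzs : ∀ z ∈ zs, z ∉ K) : False := by
  have hseg := hmax.isSegment hp
  refine hmax.false_of_replace (Ss := [a :: (ys ++ [a'])]) (Rest := Rest) (D := D) hp
    ⟨hb, hb', ?_, hzs, hchain⟩ hX hXL hXK (by simpa using hTD) hD
  rintro rfl
  obtain ⟨y, hy⟩ := List.exists_mem_of_ne_nil ys hseg.ne_nil
  have h1 : y ∈ (b :: ([] ++ [b'])) ++ D := hTD.mem_iff.2 (by simp [hy])
  have h2 := hseg.interior y hy
  simp only [List.nil_append, List.cons_append, List.mem_cons] at h1
  rcases h1 with rfl | rfl | h1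
  exacts [h2 hb, h2 hb', h2 (hD y h1)]

end IsMaxSystem

end Segments

section Ears

theorem List.isChain_insert_between {α : Type*} {R : α → α → Prop} {p q : α} {A ws B : List α}
    (h : (A ++ p :: q :: B).IsChain R) (hws : (p :: ws ++ [q]).IsChain R) :
    (A ++ p :: (ws ++ q :: B)).IsChain R := by
  rw [List.isChain_split] at h ⊢
  refine ⟨h.1, ?_⟩
  have h2 := h.2
  rw [← List.cons_append, List.isChain_split]
  exact ⟨hws, (List.isChain_cons_cons.1 h2).2⟩

variable {V : Type*} [Fintype V] [DecidableEq V] {H : SimpleGraph V} {K : Finset V}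

namespace IsMaxSystem

variable {Ls Rest : List (List V)}

theorem reverse_head {a a' y : V} {Y₁ Y₂ : List V} (hmax : IsMaxSystem H K Ls)
    (hp : Ls.Perm ((a :: ((Y₁ ++ y :: Y₂) ++ [a'])) :: Rest)) :
    IsMaxSystem H K ((a' :: ((Y₂.reverse ++ y :: Y₁.reverse) ++ [a])) :: Rest) := by
  have hperm : ((a' :: ((Y₂.reverse ++ y :: Y₁.reverse) ++ [a])) :: Rest).flatten.Perm
      Ls.flatten := by
    refine List.Perm.trans ?_ hp.flatten.symm
    rw [List.flatten_cons, List.flatten_cons]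
    refine List.Perm.append_right _ ?_
    have : (a' :: ((Y₂.reverse ++ y :: Y₁.reverse) ++ [a])) =
      (a :: ((Y₁ ++ y :: Y₂) ++ [a'])).reverse := by simp
    rw [this]
    exact List.reverse_perm _
  refine ⟨⟨?_, hperm.nodup_iff.2 hmax.nodup⟩, fun Ls' h => ?_⟩
  · intro L hL
    rcases List.mem_cons.1 hL with rfl | hL
    · refine ⟨_, _, _, rfl, ?_⟩
      have := (hmax.isSegment hp).reverse
      simpa using this
    · exact hmax.segment L (hp.mem_iff.2 (by simp [hL]))
  · rw [hperm.countP_eq]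
    exact hmax.max Ls' h

variable (hmax : IsMaxSystem H K Ls)
include hmax

theorem false_of_insert {a a' p q : V} {ys A B ws : List V}
    (hp : Ls.Perm ((a :: (ys ++ [a'])) :: Rest)) (heq : a :: (ys ++ [a']) = A ++ p :: q :: B)
    (hne : ws ≠ []) (hnd : ws.Nodup) (hws : ∀ x ∈ ws, x ∉ K ∧ x ∉ Ls.flatten)
    (hch : (p :: ws ++ [q]).IsChain H.Adj) : False := by
  have hseg := hmax.isSegment hp
  have hchain := hseg.chain
  have hint := hseg.interior
  obtain ⟨w, hw⟩ := List.exists_mem_of_ne_nil ws hne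
  rw [heq] at hchain
  have hT := List.isChain_insert_between hchain hch
  have hperm : ((A ++ p :: (ws ++ q :: B)) ++ []).Perm ((a :: (ys ++ [a'])) ++ ws) := by
    rw [heq, List.perm_iff_count]
    intro c
    simp [List.count_cons, List.count_append]
    omega
  have hfin : ∀ zs, A ++ p :: (ws ++ q :: B) = a :: (zs ++ [a']) → (∀ z ∈ zs, z ∉ K) → False := by
    intro zs hzs hzK
    rw [hzs] at hT hperm
    exact hmax.false_of_better hp hseg.left hseg.right hT hnd (fun x hx => (hws x hx).2)
      ⟨w, hw, (hws w hw).1⟩ hperm (by simp) hzK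
  rcases A with _ | ⟨a₁, A⟩ <;> rcases B.eq_nil_or_concat' with rfl | ⟨B, b, rfl⟩
  · simp only [List.nil_append, List.cons.injEq] at heq
    obtain ⟨rfl, heq⟩ := heq
    have := congrArg List.length heq
    have h0 := hseg.ne_nil
    simp at this
    exact h0 this
  · simp only [List.nil_append, List.cons.injEq] at heq
    obtain ⟨rfl, heq⟩ := heq
    rw [← List.cons_append] at heq
    obtain ⟨rfl, h2⟩ := List.append_inj' heq rfl
    obtain rfl : a' = b := by simpa using h2
    refine hfin (ws ++ q :: B) (by simp) ?_
    intro z hz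
    rcases List.mem_append.1 hz with hz | hz
    exacts [(hws z hz).1, hint z hz]
  · simp only [List.cons_append, List.cons.injEq] at heq
    obtain ⟨rfl, heq⟩ := heq
    rw [show A ++ [p, q] = (A ++ [p]) ++ [q] by simp] at heq
    obtain ⟨rfl, h2⟩ := List.append_inj' heq rfl
    obtain rfl : a' = q := by simpa using h2
    refine hfin (A ++ p :: ws) (by simp) ?_
    intro z hz
    rcases List.mem_append.1 hz with hz | hz
    · exact hint z (by simp [hz])
    · rcases List.mem_cons.1 hz with rfl | hz
      exacts [hint z (by simp), (hws z hz).1]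
  · simp only [List.cons_append, List.cons.injEq] at heq
    obtain ⟨rfl, heq⟩ := heq
    rw [show A ++ p :: q :: (B ++ [b]) = (A ++ p :: q :: B) ++ [b] by simp] at heq
    obtain ⟨rfl, h2⟩ := List.append_inj' heq rfl
    obtain rfl : a' = b := by simpa using h2
    refine hfin (A ++ p :: (ws ++ q :: B)) (by simp) ?_
    intro z hz
    by_cases hzw : z ∈ ws
    · exact (hws z hzw).1
    · refine hint z ?_
      simp [hzw] at hz ⊢
      tauto

theorem false_of_adj_adj {a a' p q w : V} {ys A B : List V}
    (hp : Ls.Perm ((a :: (ys ++ [a'])) :: Rest)) (heq : a :: (ys ++ [a']) = A ++ p :: q :: B)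
    (hw : w ∉ K) (hwL : w ∉ Ls.flatten) (hwp : H.Adj w p) (hwq : H.Adj w q) : False :=
  hmax.false_of_insert (ws := [w]) hp heq (by simp) (by simp)
    (by rintro x hx; obtain rfl := List.mem_singleton.1 hx; exact ⟨hw, hwL⟩)
    (by simp [hwp.symm, hwq])

/-- The two neighbours on a segment of an attachment vertex are adjacent. -/
theorem adj_of_attached (hclaw : ClawFree H) {a a' u w : V} {Y₁ Y₂ : List V}
    (hp : Ls.Perm ((a :: ((Y₁ ++ u :: Y₂) ++ [a'])) :: Rest)) (hw : w ∉ K)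
    (hwL : w ∉ Ls.flatten) (hwu : H.Adj w u) :
    ∀ p ∈ (a :: Y₁).getLast?, ∀ q ∈ (Y₂ ++ [a']).head?, H.Adj p q := by
  intro p hp1 q hq1
  obtain ⟨A, hA⟩ : ∃ A, a :: Y₁ = A ++ [p] := by
    rw [Option.mem_def, List.getLast?_eq_some_iff] at hp1
    exact hp1
  obtain ⟨B, hB⟩ : ∃ B, Y₂ ++ [a'] = q :: B := by
    rw [Option.mem_def, List.head?_eq_some_iff] at hq1
    exact hq1
  have heq : a :: ((Y₁ ++ u :: Y₂) ++ [a']) = A ++ p :: u :: q :: B := by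
    rw [← hB, show A ++ p :: u :: (Y₂ ++ [a']) = (A ++ [p]) ++ u :: (Y₂ ++ [a']) by simp, ← hA]
    simp
  have hch := (hmax.isSegment hp).chain
  have hnd : (a :: ((Y₁ ++ u :: Y₂) ++ [a'])).Nodup :=
    (List.nodup_flatten.1 hmax.nodup).1 _ (hp.mem_iff.2 List.mem_cons_self)
  have hsub : ∀ v ∈ A ++ p :: u :: q :: B, v ∈ Ls.flatten := fun v hv =>
    List.mem_flatten.2 ⟨_, hp.mem_iff.2 List.mem_cons_self, heq ▸ hv⟩
  rw [heq] at hch hnd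
  rw [List.isChain_append_cons_cons, List.isChain_cons_cons] at hch
  by_contra hn
  refine hclaw ⟨u, w, p, q, ?_, ?_, ?_, hwu.symm, hch.2.1.symm, hch.2.2.1, ?_, ?_, hn⟩
  · rintro rfl; exact hwL (hsub w (by simp))
  · rintro rfl; exact hwL (hsub w (by simp))
  · rintro rfl; simp [List.nodup_append] at hnd
  · exact fun hwp => hmax.false_of_adj_adj hp heq hw hwL hwp hwu
  · refine fun hwq => hmax.false_of_adj_adj (A := A ++ [p]) (B := B) hp ?_ hw hwL hwu hwq
    rw [heq]
    simp

/-- An attachment vertex of an uncovered vertex is an unused clique vertex or interior to a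
segment. -/
theorem attachment_cases (h : IsCliqueCore H K) {u w : V} (hw : w ∉ K) (hwL : w ∉ Ls.flatten)
    (hwu : H.Adj w u) (hu : ¬ (u ∉ K ∧ u ∉ Ls.flatten)) : (u ∈ K ∧ u ∉ Ls.flatten) ∨
      ∃ Rest a Y₁ Y₂ a', Ls.Perm ((a :: ((Y₁ ++ u :: Y₂) ++ [a'])) :: Rest) := by
  by_cases huL : u ∈ Ls.flatten
  swap
  · exact Or.inl ⟨by tauto, huL⟩
  right
  obtain ⟨L, hL, huL⟩ := List.mem_flatten.1 huL
  obtain ⟨a, ys, a', rfl, hseg⟩ := hmax.segment L hL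
  have hp : Ls.Perm ((a :: (ys ++ [a'])) :: Ls.erase (a :: (ys ++ [a']))) :=
    List.perm_cons_erase hL
  have hsub : ∀ v ∈ ys, v ≠ w := by
    rintro v hv rfl
    exact hwL (List.mem_flatten.2 ⟨_, hL, by simp [hv]⟩)
  have hch := hseg.chain
  rcases List.mem_cons.1 huL with rfl | hu'
  · exfalso
    rcases ys with _ | ⟨y, ys⟩
    · exact hseg.ne_nil rfl
    rw [List.cons_append, List.isChain_cons_cons] at hch
    have hyw := h.adj_of_common hseg.left (hseg.interior y (by simp)) hw (hsub y (by simp))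
      hch.1 hwu.symm
    exact hmax.false_of_adj_adj (A := []) hp rfl hw hwL hwu hyw.symm
  rcases List.mem_append.1 hu' with hu' | hu'
  · obtain ⟨Y₁, Y₂, rfl⟩ := List.append_of_mem hu'
    exact ⟨_, a, Y₁, Y₂, a', hp⟩
  · exfalso
    obtain rfl : u = a' := by simpa using hu'
    rcases ys.eq_nil_or_concat' with rfl | ⟨ys, y, rfl⟩
    · exact hseg.ne_nil rfl
    have heq : a :: ((ys ++ [y]) ++ [u]) = (a :: ys) ++ y :: u :: [] := by simp
    rw [heq, List.isChain_append_cons_cons] at hch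
    have hyw := h.adj_of_common hseg.right (hseg.interior y (by simp)) hw (hsub y (by simp))
      hch.2.1.symm hwu.symm
    exact hmax.false_of_adj_adj hp heq hw hwL hyw.symm hwu

/-- An ear from an unused clique vertex to a segment extends the segment if it meets it close to
its left end. -/
theorem false_of_short_left (hclaw : ClawFree H) {a a' u y : V} {Y₁ Y₂ ws : List V}
    (hp : Ls.Perm ((a :: ((Y₁ ++ y :: Y₂) ++ [a'])) :: Rest)) (hu : u ∈ K)
    (huL : u ∉ Ls.flatten) (hne : ws ≠ []) (hnd : ws.Nodup)
    (hws : ∀ x ∈ ws, x ∉ K ∧ x ∉ Ls.flatten) (hch : (u :: ws ++ [y]).IsChain H.Adj)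
    (hlen : Y₁.length ≤ 1) : False := by
  have hseg := hmax.isSegment hp
  have hchain := hseg.chain
  obtain ⟨w, hw⟩ := List.exists_mem_of_ne_nil ws hne
  have hX : (u :: ws).Nodup := List.nodup_cons.2 ⟨fun h => (hws u h).1 hu, hnd⟩
  have hXL : ∀ x ∈ u :: ws, x ∉ Ls.flatten := by
    intro x hx
    rcases List.mem_cons.1 hx with rfl | hx
    exacts [huL, (hws x hx).2]
  have hXK : ∃ x ∈ u :: ws, x ∉ K := ⟨w, by simp [hw], (hws w hw).1⟩
  have hwl : ∃ z ∈ ws, H.Adj z y := by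
    rcases ws.eq_nil_or_concat' with rfl | ⟨ws, z, rfl⟩
    · exact absurd rfl hne
    refine ⟨z, by simp, ?_⟩
    rw [show u :: (ws ++ [z]) ++ [y] = (u :: ws) ++ z :: y :: [] by simp,
      List.isChain_append_cons_cons] at hch
    exact hch.2.1
  obtain ⟨z, hz, hzy⟩ := hwl
  have hpq := hmax.adj_of_attached hclaw hp (hws z hz).1 (hws z hz).2 hzy
  have hsplit : (a :: Y₁ ++ [y]).IsChain H.Adj ∧ (y :: (Y₂ ++ [a'])).IsChain H.Adj := by
    rw [show a :: ((Y₁ ++ y :: Y₂) ++ [a']) = (a :: Y₁) ++ y :: (Y₂ ++ [a']) by simp,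
      List.isChain_split] at hchain
    exact hchain
  rcases Y₁ with _ | ⟨p, _ | ⟨p', Y₁⟩⟩
  · refine hmax.false_of_better (zs := ws ++ y :: Y₂) (D := [a]) hp hu hseg.right ?_ hX hXL hXK ?_
      (by simpa using hseg.left) ?_
    · rw [show u :: (ws ++ y :: Y₂ ++ [a']) = (u :: ws) ++ y :: (Y₂ ++ [a']) by simp,
        List.isChain_split]
      exact ⟨hch, hsplit.2⟩
    · rw [List.perm_iff_count]
      intro c
      simp [List.count_cons, List.count_append]
      omega
    · intro z hz
      rcases List.mem_append.1 hz with hz | hz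
      exacts [(hws z hz).1, hseg.interior z (by simpa using hz)]
  · refine hmax.false_of_better (zs := ws ++ y :: p :: Y₂) (D := [a]) hp hu hseg.right ?_ hX hXL
      hXK ?_ (by simpa using hseg.left) ?_
    · rw [show u :: (ws ++ y :: p :: Y₂ ++ [a']) = (u :: ws) ++ y :: p :: (Y₂ ++ [a']) by simp,
        List.isChain_split]
      have h1 := hsplit.1
      rw [List.cons_append, List.singleton_append, List.isChain_cons_cons,
        List.isChain_cons_cons] at h1
      refine ⟨hch, List.isChain_cons_cons.2 ⟨h1.2.1.symm, List.isChain_cons.2 ⟨?_, ?_⟩⟩⟩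
      · exact hpq p (by simp)
      · exact (List.isChain_cons.1 hsplit.2).2
    · rw [List.perm_iff_count]
      intro c
      simp [List.count_cons, List.count_append]
      omega
    · intro z hz
      rcases List.mem_append.1 hz with hz | hz
      exacts [(hws z hz).1, hseg.interior z (by simp at hz ⊢; tauto)]
  · simp at hlen

theorem interior_ears_nodup {a a' : V} {ys ws : List V}
    (hp : Ls.Perm ((a :: (ys ++ [a'])) :: Rest)) (hnd : ws.Nodup)
    (hws : ∀ x ∈ ws, x ∉ K ∧ x ∉ Ls.flatten) :
    (ys ++ ws).Nodup ∧ ∀ x ∈ ys ++ ws, x ∉ K := by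
  have hseg := hmax.isSegment hp
  have hmem := hp.mem_iff.2 List.mem_cons_self
  have hnd' : (a :: (ys ++ [a'])).Nodup := (List.nodup_flatten.1 hmax.nodup).1 _ hmem
  refine ⟨List.nodup_append.2 ⟨?_, hnd, ?_⟩, ?_⟩
  · exact (List.nodup_append.1 (List.nodup_cons.1 hnd').2).1
  · rintro x hx y hy rfl
    exact (hws x hy).2 (List.mem_flatten.2 ⟨_, hmem, by simp [hx]⟩)
  · intro x hx
    rcases List.mem_append.1 hx with hx | hx
    exacts [hseg.interior x hx, (hws x hx).1]

theorem ear_free_segment (h : IsCliqueCore H K) {a a' u y : V} {Y₁ Y₂ ws : List V}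
    (hp : Ls.Perm ((a :: ((Y₁ ++ y :: Y₂) ++ [a'])) :: Rest)) (hu : u ∈ K)
    (huL : u ∉ Ls.flatten) (hne : ws ≠ []) (hnd : ws.Nodup)
    (hws : ∀ x ∈ ws, x ∉ K ∧ x ∉ Ls.flatten) (hch : (u :: ws ++ [y]).IsChain H.Adj) :
    ∃ c₁ b₁ b₃ c₃ w, Y₁ = [c₁, b₁] ∧ Y₂ = [b₃, c₃] ∧ ws = [w] := by
  have h1 : ¬ Y₁.length ≤ 1 := hmax.false_of_short_left h.claw hp hu huL hne hnd hws hch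
  have h2 : ¬ Y₂.length ≤ 1 := by
    intro h2
    have hflat : ((a' :: ((Y₂.reverse ++ y :: Y₁.reverse) ++ [a])) :: Rest).flatten.Perm
        Ls.flatten := by
      refine List.Perm.trans ?_ hp.flatten.symm
      rw [List.perm_iff_count]
      intro c
      simp [List.count_cons, List.count_append]
      omega
    exact (hmax.reverse_head hp).false_of_short_left h.claw (.refl _) hu
      (by rwa [hflat.mem_iff]) hne hnd (by simpa only [hflat.mem_iff] using hws) hch
      (by simpa using h2)
  obtain ⟨h3, h4⟩ := hmax.interior_ears_nodup hp hnd hws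
  have h5 := h.length_le h3 h4
  have h6 := List.length_pos_iff.2 hne
  simp only [List.length_append, List.length_cons] at h5
  obtain ⟨c₁, b₁, rfl⟩ := List.length_eq_two.1 (by omega : Y₁.length = 2)
  obtain ⟨b₃, c₃, rfl⟩ := List.length_eq_two.1 (by omega : Y₂.length = 2)
  obtain ⟨w, rfl⟩ := List.length_eq_one_iff.1 (by simp at h5; omega : ws.length = 1)
  exact ⟨c₁, b₁, b₃, c₃, w, rfl, rfl, rfl⟩

end IsMaxSystem

end Ears

section EarCases

theorem exists_adj_ends {V : Type*} {H : SimpleGraph V} {u v : V} {ws : List V} (hne : ws ≠ [])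
    (hch : (u :: ws ++ [v]).IsChain H.Adj) : (∃ z ∈ ws, H.Adj z u) ∧ ∃ z ∈ ws, H.Adj z v := by
  constructor
  · rcases ws with _ | ⟨z, ws⟩
    · exact absurd rfl hne
    exact ⟨z, by simp, (List.isChain_cons_cons.1 hch).1.symm⟩
  · rcases ws.eq_nil_or_concat' with rfl | ⟨ws, z, rfl⟩
    · exact absurd rfl hne
    refine ⟨z, by simp, ?_⟩
    rw [show u :: (ws ++ [z]) ++ [v] = (u :: ws) ++ z :: v :: [] by simp,
      List.isChain_append_cons_cons] at hch
    exact hch.2.1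

variable {V : Type*} [Fintype V] [DecidableEq V] {H : SimpleGraph V} {K : Finset V}

namespace IsMaxSystem

variable {Ls Rest : List (List V)} (hmax : IsMaxSystem H K Ls)
include hmax

theorem false_of_flip (hclaw : ClawFree H) {a a' u v m : V} {Y₁ M Y₂ ws : List V}
    (hp : Ls.Perm ((a :: ((Y₁ ++ u :: ((m :: M) ++ v :: Y₂)) ++ [a'])) :: Rest))
    (hne : ws ≠ []) (hnd : ws.Nodup) (hws : ∀ x ∈ ws, x ∉ K ∧ x ∉ Ls.flatten)
    (hch : (u :: ws ++ [v]).IsChain H.Adj) (hlen : M.length ≤ 1) : False := by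
  have hseg := hmax.isSegment hp
  have hchain := hseg.chain
  obtain ⟨w, hw⟩ := List.exists_mem_of_ne_nil ws hne
  obtain ⟨⟨z, hz, hzu⟩, ⟨z', hz', hzv⟩⟩ := exists_adj_ends hne hch
  have hadj₁ := hmax.adj_of_attached hclaw hp (hws z hz).1 (hws z hz).2 hzu
  have hp' : Ls.Perm ((a :: (((Y₁ ++ u :: (m :: M)) ++ v :: Y₂) ++ [a'])) :: Rest) := by
    simpa using hp
  have hadj₂ := hmax.adj_of_attached hclaw hp' (hws z' hz').1 (hws z' hz').2 hzv
  rw [show a :: ((Y₁ ++ u :: ((m :: M) ++ v :: Y₂)) ++ [a']) =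
    (a :: Y₁) ++ (u :: (m :: M) ++ v :: (Y₂ ++ [a'])) by simp, List.isChain_append] at hchain
  obtain ⟨hc1, hc2, -⟩ := hchain
  rw [List.isChain_split] at hc2
  obtain ⟨hc2, hc3⟩ := hc2
  rw [List.cons_append, List.cons_append, List.isChain_cons_cons] at hc2
  rw [List.isChain_cons] at hc3
  refine hmax.false_of_better (zs := Y₁ ++ m :: u :: (ws ++ v :: (M ++ Y₂))) (D := []) hp
    hseg.left hseg.right ?_ hnd (fun x hx => (hws x hx).2) ⟨w, hw, (hws w hw).1⟩ ?_ (by simp) ?_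
  · rw [show a :: ((Y₁ ++ m :: u :: (ws ++ v :: (M ++ Y₂))) ++ [a']) =
      (a :: Y₁) ++ (m :: (u :: ws ++ v :: (M ++ (Y₂ ++ [a'])))) by simp, List.isChain_append]
    refine ⟨hc1, List.isChain_cons.2 ⟨?_, List.isChain_split.2 ⟨hch, ?_⟩⟩, ?_⟩
    · simpa using hc2.1.symm
    · rcases M with _ | ⟨m', _ | ⟨m'', M⟩⟩
      · simpa using List.isChain_cons.2 hc3
      · have h1 : H.Adj m' v := by
          have := hc2.2
          simp at this
          exact this.2
        rw [List.singleton_append, List.isChain_cons_cons, List.isChain_cons]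
        refine ⟨h1.symm, fun q hq => hadj₂ m' ?_ q hq, hc3.2⟩
        rw [show a :: (Y₁ ++ u :: [m, m']) = (a :: (Y₁ ++ [u, m])) ++ [m'] by simp]
        exact List.getLast?_concat
      · simp at hlen
    · intro p hp q hq
      exact hadj₁ p hp q (by simpa using hq)
  · rw [List.perm_iff_count]
    intro c
    simp [List.count_cons, List.count_append]
    omega
  · intro z hz
    by_cases hzw : z ∈ ws
    · exact (hws z hzw).1
    · refine hseg.interior z ?_
      simp [hzw] at hz ⊢
      tauto

theorem ear_same_segment (h : IsCliqueCore H K) {a a' u v : V} {Y₁ M Y₂ ws : List V}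
    (hp : Ls.Perm ((a :: ((Y₁ ++ u :: (M ++ v :: Y₂)) ++ [a'])) :: Rest))
    (hne : ws ≠ []) (hnd : ws.Nodup) (hws : ∀ x ∈ ws, x ∉ K ∧ x ∉ Ls.flatten)
    (hch : (u :: ws ++ [v]).IsChain H.Adj) :
    ∃ m₁ m₂ m₃ w, Y₁ = [] ∧ Y₂ = [] ∧ M = [m₁, m₂, m₃] ∧ ws = [w] := by
  obtain ⟨h3, h4⟩ := hmax.interior_ears_nodup hp hnd hws
  have h5 := h.length_le h3 h4
  have h6 := List.length_pos_iff.2 hne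
  simp only [List.length_append, List.length_cons] at h5
  have hM : 3 ≤ M.length := by
    rcases M with _ | ⟨m, M⟩
    · exact (hmax.false_of_insert (A := a :: Y₁) (B := Y₂ ++ [a']) hp (by simp) hne hnd hws
        hch).elim
    · by_contra hlt
      exact hmax.false_of_flip h.claw hp hne hnd hws hch (by simp at hlt; omega)
  obtain ⟨m₁, m₂, m₃, rfl⟩ := List.length_eq_three.1 (by omega : M.length = 3)
  obtain ⟨w, rfl⟩ := List.length_eq_one_iff.1 (by simp at h5; omega : ws.length = 1)
  simp at h5
  exact ⟨m₁, m₂, m₃, w, List.length_eq_zero_iff.1 (by omega), List.length_eq_zero_iff.1 (by omega),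
    rfl, rfl⟩

theorem three_le_of_attached (h : IsCliqueCore H K) {a a' u w : V} {Y₁ Y₂ : List V}
    (hp : Ls.Perm ((a :: ((Y₁ ++ u :: Y₂) ++ [a'])) :: Rest)) (hw : w ∉ K)
    (hwL : w ∉ Ls.flatten) (hwu : H.Adj w u) : 3 ≤ (Y₁ ++ u :: Y₂).length := by
  have hseg := hmax.isSegment hp
  have hadj := hmax.adj_of_attached h.claw hp hw hwL hwu
  have hchain := hseg.chain
  have hnd : (a :: ((Y₁ ++ u :: Y₂) ++ [a'])).Nodup :=
    (List.nodup_flatten.1 hmax.nodup).1 _ (hp.mem_iff.2 List.mem_cons_self)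
  by_contra hlt
  have huK := hseg.interior u (by simp)
  rcases Y₁ with _ | ⟨p, Y₁⟩
  · rcases Y₂ with _ | ⟨q, _ | ⟨q', Y₂⟩⟩
    · simp at hchain hnd
      exact hnd.1.2 (h.uniq u huK _ hseg.left _ hseg.right hchain.1.symm hchain.2)
    · simp at hchain hnd hadj
      exact hnd.1.2.2 (h.uniq q (hseg.interior q (by simp)) _ hseg.left _ hseg.right hadj.symm
        hchain.2.2)
    · simp at hlt
  · rcases Y₁ with _ | ⟨q, Y₁⟩
    · rcases Y₂ with _ | ⟨q', Y₂⟩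
      · simp at hchain hnd hadj
        exact hnd.1.2.2 (h.uniq p (hseg.interior p (by simp)) _ hseg.left _ hseg.right
          hchain.1.symm hadj)
      · simp at hlt
    · simp at hlt

theorem ears_disjoint (h : IsCliqueCore H K) {a a' b b' u v w w' : V} {Y₁ Y₂ Z₁ Z₂ ws : List V}
    {Rest' : List (List V)} (hp : Ls.Perm ((a :: ((Y₁ ++ u :: Y₂) ++ [a'])) :: Rest))
    (hp' : Ls.Perm ((b :: ((Z₁ ++ v :: Z₂) ++ [b'])) :: Rest'))
    (hnd : ws.Nodup) (hws : ∀ x ∈ ws, x ∉ K ∧ x ∉ Ls.flatten) (hw : w ∈ ws) (hw' : w' ∈ ws)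
    (hwu : H.Adj w u) (hwv : H.Adj w' v) : v ∈ Y₁ ++ u :: Y₂ := by
  by_contra hv
  have h1 := hmax.three_le_of_attached h hp (hws w hw).1 (hws w hw).2 hwu
  have h2 := hmax.three_le_of_attached h hp' (hws w' hw').1 (hws w' hw').2 hwv
  have hmem : (b :: ((Z₁ ++ v :: Z₂) ++ [b'])) ∈ Rest := by
    have := hp.mem_iff.1 (hp'.mem_iff.2 List.mem_cons_self)
    rcases List.mem_cons.1 this with heq | hR
    · exfalso
      have h4 := List.append_inj' (List.cons.inj heq).2 rfl
      exact hv (h4.1 ▸ by simp)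
    · exact hR
  have hnd' := hp.flatten.nodup_iff.1 hmax.nodup
  rw [List.flatten_cons, List.nodup_append] at hnd'
  obtain ⟨h3, h4⟩ := hmax.interior_ears_nodup hp' hnd hws
  obtain ⟨h5, h6⟩ := hmax.interior_ears_nodup hp hnd hws
  have h7 := h.length_le (l := (Y₁ ++ u :: Y₂) ++ ((Z₁ ++ v :: Z₂) ++ ws)) ?_ ?_
  · have h8 := List.length_pos_of_mem hw
    simp only [List.length_append] at h1 h2 h7
    omega
  · refine List.nodup_append.2 ⟨(List.nodup_append.1 h5).1, h3, ?_⟩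
    rintro x hx y hy rfl
    rcases List.mem_append.1 hy with hy | hy
    · refine hnd'.2.2 x ?_ x (List.mem_flatten.2 ⟨_, hmem, ?_⟩) rfl
      · exact List.mem_cons_of_mem _ (List.mem_append_left _ hx)
      · exact List.mem_cons_of_mem _ (List.mem_append_left _ hy)
    · exact (List.nodup_append.1 h5).2.2 x hx x hy rfl
  · intro x hx
    rcases List.mem_append.1 hx with hx | hx
    exacts [h6 x (List.mem_append_left _ hx), h4 x hx]

/-- One of the two exceptional configurations occurs. -/
theorem exists_exceptional (h : IsCliqueCore H K) (h2 : TwoConnected H) :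
    (∃ Rest a c₁ b₁ b₂ b₃ c₃ a₃ u w,
      Ls.Perm ((a :: (([c₁, b₁] ++ b₂ :: [b₃, c₃]) ++ [a₃])) :: Rest) ∧
      u ∈ K ∧ u ∉ Ls.flatten ∧ w ∉ K ∧ w ∉ Ls.flatten ∧ H.Adj w u ∧ H.Adj w b₂) ∨
    ∃ Rest a y₁ y₂ y₃ y₄ y₅ a' w,
      Ls.Perm ((a :: (([] ++ y₁ :: [y₂, y₃, y₄, y₅]) ++ [a'])) :: Rest) ∧
      w ∉ K ∧ w ∉ Ls.flatten ∧ H.Adj w y₁ ∧ H.Adj w y₅ := by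
  obtain ⟨w, hw, hwL⟩ : ∃ w ∉ K, w ∉ Ls.flatten := by
    by_contra! hall
    refine h.false_of_cover (fun P hP => ?_) hmax.nodup hall
    obtain ⟨a, ys, a', rfl, hseg⟩ := hmax.segment P hP
    exact hseg.isEndedChain
  obtain ⟨s, hs, t, ht, hst⟩ := Finset.one_lt_card.1 h.two_le
  obtain ⟨u, v, ws, hu, hv, huv, hne, hnd, hws, hch⟩ :=
    h2.exists_ear (U := {v | v ∉ K ∧ v ∉ Ls.flatten}) ⟨hw, hwL⟩ (fun h' => h'.1 hs)
      (fun h' => h'.1 ht) hst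
  clear hwL hw w
  have hws' : ∀ x ∈ ws, x ∉ K ∧ x ∉ Ls.flatten := hws
  obtain ⟨⟨z, hz, hzu⟩, ⟨z', hz', hzv⟩⟩ := exists_adj_ends hne hch
  have hch' : (v :: ws.reverse ++ [u]).IsChain H.Adj := by
    rw [← List.isChain_reverse] at hch
    simpa [H.adj_comm] using hch
  have hws'' : ∀ x ∈ ws.reverse, x ∉ K ∧ x ∉ Ls.flatten := by simpa using hws'
  have hmixed : ∀ {u v ws}, u ∈ K → u ∉ Ls.flatten → ws ≠ [] → ws.Nodup →
      (∀ x ∈ ws, x ∉ K ∧ x ∉ Ls.flatten) → (u :: ws ++ [v]).IsChain H.Adj →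
      (∃ Rest a Y₁ Y₂ a', Ls.Perm ((a :: ((Y₁ ++ v :: Y₂) ++ [a'])) :: Rest)) →
      ∃ Rest a c₁ b₁ b₂ b₃ c₃ a₃ u w,
      Ls.Perm ((a :: (([c₁, b₁] ++ b₂ :: [b₃, c₃]) ++ [a₃])) :: Rest) ∧
      u ∈ K ∧ u ∉ Ls.flatten ∧ w ∉ K ∧ w ∉ Ls.flatten ∧ H.Adj w u ∧ H.Adj w b₂ := by
    rintro u v ws huK huL hne hnd hws hch ⟨Rest, a, Y₁, Y₂, a', hp⟩
    obtain ⟨c₁, b₁, b₃, c₃, w, rfl, rfl, rfl⟩ := hmax.ear_free_segment h hp huK huL hne hnd hws hch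
    have hw := hws w (by simp)
    simp at hch
    exact ⟨Rest, a, c₁, b₁, v, b₃, c₃, a', u, w, hp, huK, huL, hw.1, hw.2, hch.1.symm, hch.2⟩
  have hsame : ∀ {u v ws a a' M Y₁ Y₂ Rest}, ws ≠ [] → ws.Nodup →
      (∀ x ∈ ws, x ∉ K ∧ x ∉ Ls.flatten) → (u :: ws ++ [v]).IsChain H.Adj →
      Ls.Perm ((a :: ((Y₁ ++ u :: (M ++ v :: Y₂)) ++ [a'])) :: Rest) →
      ∃ Rest a y₁ y₂ y₃ y₄ y₅ a' w,
      Ls.Perm ((a :: (([] ++ y₁ :: [y₂, y₃, y₄, y₅]) ++ [a'])) :: Rest) ∧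
      w ∉ K ∧ w ∉ Ls.flatten ∧ H.Adj w y₁ ∧ H.Adj w y₅ := by
    rintro u v ws a a' M Y₁ Y₂ Rest hne hnd hws hch hp
    obtain ⟨m₁, m₂, m₃, w, rfl, rfl, rfl, rfl⟩ := hmax.ear_same_segment h hp hne hnd hws hch
    have hw := hws w (by simp)
    simp at hch
    exact ⟨Rest, a, u, m₁, m₂, m₃, v, a', w, hp, hw.1, hw.2, hch.1.symm, hch.2⟩
  rcases hmax.attachment_cases h (hws' z hz).1 (hws' z hz).2 hzu hu with ⟨huK, huL⟩ | hu
  · rcases hmax.attachment_cases h (hws' z' hz').1 (hws' z' hz').2 hzv hv with ⟨hvK, hvL⟩ | hv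
    · exfalso
      refine hmax.false_of_new (ys := ws) ⟨huK, hvK, hne, fun y hy => (hws' y hy).1, hch⟩ ?_ ?_
      · refine List.nodup_cons.2 ⟨?_, List.nodup_append.2 ⟨hnd, by simp, ?_⟩⟩
        · simp only [List.mem_append, List.mem_singleton, not_or]
          exact ⟨fun h' => (hws' u h').1 huK, huv⟩
        · rintro x hx y hy rfl
          obtain rfl := List.mem_singleton.1 hy
          exact (hws' x hx).1 hvK
      · intro x hx
        simp only [List.mem_cons, List.mem_append, List.not_mem_nil, or_false] at hx
        rcases hx with rfl | hx | rfl
        exacts [huL, (hws' x hx).2, hvL]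
    · exact Or.inl (hmixed huK huL hne hnd hws' hch hv)
  · rcases hmax.attachment_cases h (hws' z' hz').1 (hws' z' hz').2 hzv hv with ⟨hvK, hvL⟩ | hv
    · exact Or.inl (hmixed hvK hvL (by simpa using hne) (by simpa using hnd) hws'' hch' hu)
    · right
      obtain ⟨Rest, a, Y₁, Y₂, a', hp⟩ := hu
      obtain ⟨Rest', b, Z₁, Z₂, b', hp'⟩ := hv
      have hvm := hmax.ears_disjoint h hp hp' hnd hws' hz hz' hzu hzv
      rcases List.mem_append.1 hvm with hvm | hvm
      · obtain ⟨A, M, rfl⟩ := List.append_of_mem hvm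
        refine hsame (by simpa using hne) (by simpa using hnd) hws'' hch' (M := M) (Y₁ := A)
          (Y₂ := Y₂) (a := a) (a' := a') (Rest := Rest) ?_
        simpa using hp
      · obtain ⟨M, B, rfl⟩ := List.append_of_mem ((List.mem_cons.1 hvm).resolve_left huv.symm)
        exact hsame hne hnd hws' hch hp

end IsMaxSystem

end EarCases

section Hexagons

variable {V : Type*} [Fintype V] [DecidableEq V] {H : SimpleGraph V} {K : Finset V}

/-- Two clique vertices joined by a five-vertex path outside the clique whose ends have a further
common neighbour, which sees no clique vertex. -/
structure IsHexagonConfig (H : SimpleGraph V) (K : Finset V) (x x' y₁ y₂ y₃ y₄ y₅ w : V) :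
    Prop where
  nodup : [x, x', y₁, y₂, y₃, y₄, y₅, w].Nodup
  left : x ∈ K
  right : x' ∈ K
  notMem : ∀ r ∈ [y₁, y₂, y₃, y₄, y₅, w], r ∉ K
  adj_x₁ : H.Adj x y₁
  adj_x₂ : H.Adj x y₂
  adj₁₂ : H.Adj y₁ y₂
  adj₂₃ : H.Adj y₂ y₃
  adj₃₄ : H.Adj y₃ y₄
  adj₄₅ : H.Adj y₄ y₅
  adj_x'₄ : H.Adj y₄ x'
  adj_x'₅ : H.Adj y₅ x'
  adj_w₁ : H.Adj w y₁
  adj_w₅ : H.Adj w y₅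
  free : ∀ z ∈ K, ¬ H.Adj w z

theorem IsMaxSystem.isHexagonConfig {Ls Rest : List (List V)} (hmax : IsMaxSystem H K Ls)
    (h : IsCliqueCore H K) {a y₁ y₂ y₃ y₄ y₅ a' w : V}
    (hp : Ls.Perm ((a :: (([] ++ y₁ :: [y₂, y₃, y₄, y₅]) ++ [a'])) :: Rest))
    (hw : w ∉ K) (hwL : w ∉ Ls.flatten) (hw₁ : H.Adj w y₁) (hw₅ : H.Adj w y₅) :
    IsHexagonConfig H K a a' y₁ y₂ y₃ y₄ y₅ w := by
  have hseg := hmax.isSegment hp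
  have hchain := hseg.chain
  have hint := hseg.interior
  have hmem := hp.mem_iff.2 List.mem_cons_self
  have hnd : (a :: (([] ++ y₁ :: [y₂, y₃, y₄, y₅]) ++ [a'])).Nodup :=
    (List.nodup_flatten.1 hmax.nodup).1 _ hmem
  have hp' : Ls.Perm ((a :: (([y₁, y₂, y₃, y₄] ++ y₅ :: []) ++ [a'])) :: Rest) := by
    simpa using hp
  have h1 : H.Adj a y₂ := by
    simpa using hmax.adj_of_attached h.claw hp hw hwL hw₁
  have h2 : H.Adj y₄ a' := by
    simpa using hmax.adj_of_attached h.claw hp' hw hwL hw₅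
  have hwl : w ∉ (a :: (([] ++ y₁ :: [y₂, y₃, y₄, y₅]) ++ [a'])) := fun h' =>
    hwL (List.mem_flatten.2 ⟨_, hmem, h'⟩)
  have hnd' := List.nodup_cons.2 ⟨hwl, hnd⟩
  have hperm : [a, a', y₁, y₂, y₃, y₄, y₅, w].Perm
      (w :: (a :: (([] ++ y₁ :: [y₂, y₃, y₄, y₅]) ++ [a']))) := by
    rw [List.perm_iff_count]
    intro c
    simp [List.count_cons]
    omega
  simp only [List.nil_append, List.cons_append, List.isChain_cons_cons] at hchain
  obtain ⟨e1, e2, e3, e4, e5, e6, -⟩ := hchain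
  refine ⟨hperm.nodup_iff.2 hnd', hseg.left, hseg.right, ?_, e1, h1, e2, e3, e4, e5, h2, e6,
    hw₁, hw₅, ?_⟩
  · intro r hr
    by_cases hrw : r = w
    · exact hrw ▸ hw
    · exact hint r (by simp [hrw] at hr ⊢; tauto)
  · intro z hz hwz
    rcases hmax.attachment_cases h hw hwL hwz fun h' => h'.1 hz with ⟨-, hzL⟩ | ⟨_, _, _, _, _, hp2⟩
    · obtain ⟨_, _, _, _, _, h3, -⟩ := hmax.ear_free_segment h hp hz hzL (ws := [w]) (by simp)
        (by simp) (by rintro x hx; obtain rfl := List.mem_singleton.1 hx; exact ⟨hw, hwL⟩)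
        (by simp [hwz.symm, hw₁])
      simp at h3
    · exact (hmax.isSegment hp2).interior z (by simp) hz

namespace IsHexagonConfig

variable {x x' y₁ y₂ y₃ y₄ y₅ w : V} (hx : IsHexagonConfig H K x x' y₁ y₂ y₃ y₄ y₅ w)
  (h : IsCliqueCore H K)
include hx h

theorem mem {r : V} (hr : r ∉ K) : r ∈ [y₁, y₂, y₃, y₄, y₅, w] :=
  h.mem_of_length (hx.nodup.sublist (by simp)) hx.notMem (by simp) hr

theorem not_adj_middle {z : V} (hz : z ∈ K) : ¬ H.Adj y₃ z := by
  intro hyz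
  have hnd := hx.nodup
  have hm : ∀ r ∈ [y₁, y₂, y₃, y₄, y₅, w], r ∉ K := hx.notMem
  have hcov : ∀ P : List V, IsEndedChain H K P → P.Nodup → [y₁, y₂, y₃, y₄, y₅, w] ⊆ P → False := by
    intro P hP hnd hsub
    exact h.false_of_cover (Ps := [P]) (by simpa using hP) (by simpa using hnd) fun r hr => by
      simpa using hsub (hx.mem h hr)
  by_cases hzx : z = x
  · subst hzx
    have h13 : H.Adj y₁ y₃ := h.adj_of_common hx.left (hm _ (by simp)) (hm _ (by simp))
      (by rintro rfl; simp at hnd) hx.adj_x₁ hyz.symm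
    refine hcov [z, y₂, y₃, y₁, w, y₅, y₄, x'] ⟨by simp, ?_, ?_, ?_⟩ ?_ ?_
    · simp [hx.adj_x₂, hx.adj₂₃, h13.symm, hx.adj_w₁.symm, hx.adj_w₅, hx.adj₄₅.symm, hx.adj_x'₄]
    · simpa using hz
    · simpa using hx.right
    · refine (List.Perm.nodup_iff ?_).2 hnd
      rw [List.perm_iff_count]
      intro c
      simp [List.count_cons]
      omega
    · intro r; simp; tauto
  by_cases hzx' : z = x'
  · subst hzx'
    have h35 : H.Adj y₃ y₅ := h.adj_of_common hx.right (hm _ (by simp)) (hm _ (by simp))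
      (by rintro rfl; simp at hnd) hyz.symm hx.adj_x'₅.symm
    refine hcov [x, y₂, y₁, w, y₅, y₃, y₄, z] ⟨by simp, ?_, ?_, ?_⟩ ?_ ?_
    · simp [hx.adj_x₂, hx.adj₁₂.symm, h35.symm, hx.adj_w₁.symm, hx.adj_w₅, hx.adj₃₄, hx.adj_x'₄]
    · simpa using hx.left
    · simpa using hz
    · refine (List.Perm.nodup_iff ?_).2 hnd
      rw [List.perm_iff_count]
      intro c
      simp [List.count_cons]
      omega
    · intro r; simp; tauto
  · refine hcov [z, y₃, y₂, y₁, w, y₅, y₄, x'] ⟨by simp, ?_, ?_, ?_⟩ ?_ ?_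
    · simp [hyz.symm, hx.adj₂₃.symm, hx.adj₁₂.symm, hx.adj_w₁.symm, hx.adj_w₅, hx.adj₄₅.symm,
        hx.adj_x'₄]
    · simpa using hz
    · simpa using hx.right
    · have h1 : (z :: [x, x', y₁, y₂, y₃, y₄, y₅, w]).Nodup := by
        refine List.nodup_cons.2 ⟨fun hmem => ?_, hnd⟩
        exact hm z (by simp [hzx, hzx'] at hmem ⊢; tauto) hz
      refine (List.Perm.nodup_iff ?_).2 (h1.erase x)
      rw [List.perm_iff_count]
      intro c
      have h2 : (z :: [x, x', y₁, y₂, y₃, y₄, y₅, w]).erase x =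
          z :: [x', y₁, y₂, y₃, y₄, y₅, w] := by
        rw [List.erase_cons_tail (by simpa using hzx), List.erase_cons_head]
      rw [h2]
      simp [List.count_cons]
      omega
    · intro r; simp; tauto

theorem eq_of_adj {v r : V} (hv : v ∈ K) (hr : r ∉ K) (hvr : H.Adj v r) :
    (v = x ∧ (r = y₁ ∨ r = y₂)) ∨ (v = x' ∧ (r = y₄ ∨ r = y₅)) := by
  have hmem := hx.mem h hr
  simp only [List.mem_cons, List.not_mem_nil, or_false] at hmem
  rcases hmem with rfl | rfl | rfl | rfl | rfl | rfl
  · exact Or.inl ⟨h.uniq _ hr _ hv _ hx.left hvr.symm hx.adj_x₁.symm, Or.inl rfl⟩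
  · exact Or.inl ⟨h.uniq _ hr _ hv _ hx.left hvr.symm hx.adj_x₂.symm, Or.inr rfl⟩
  · exact (hx.not_adj_middle h hv hvr.symm).elim
  · exact Or.inr ⟨h.uniq _ hr _ hv _ hx.right hvr.symm hx.adj_x'₄, Or.inl rfl⟩
  · exact Or.inr ⟨h.uniq _ hr _ hv _ hx.right hvr.symm hx.adj_x'₅, Or.inr rfl⟩
  · exact (hx.free _ hv hvr.symm).elim

theorem qIndex_mul_le (hn : 51 ≤ Fintype.card V) : Fintype.card V = K.card + 6 ∧
    qIndex H * K.card ≤ K.card * (2 * K.card - 2) + 5 := by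
  have hnd := hx.nodup
  have hxx : x ≠ x' := by rintro rfl; simp at hnd
  have hcompl : 6 ≤ Kᶜ.card := by
    have h6 := List.toFinset_card_of_nodup
      (hnd.sublist (by simp) : [y₁, y₂, y₃, y₄, y₅, w].Nodup)
    rw [show 6 = [y₁, y₂, y₃, y₄, y₅, w].length from rfl, ← h6]
    exact Finset.card_le_card fun r hr => by
      simpa using hx.notMem r (by simpa using hr)
  have hcard : Fintype.card V = K.card + 6 := by
    have := h.small
    have := K.card_add_card_compl
    omega
  have : Nonempty V := ⟨x⟩
  refine ⟨hcard, qIndex_mul_le_of_two_attachments (by omega) hcard rfl hx.left hx.right hxx ?_ ?_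
    h.uniq⟩
  · intro v hv hvx hvx' r hr hvr
    rcases hx.eq_of_adj h hv hr hvr with ⟨h1, -⟩ | ⟨h1, -⟩
    exacts [hvx h1, hvx' h1]
  · intro v hv
    by_cases hvx : v = x
    · refine (Set.ncard_le_ncard (t := {y₁, y₂}) ?_).trans ((Set.ncard_insert_le _ _).trans (by simp))
      rintro r ⟨hr, hvr⟩
      rcases hx.eq_of_adj h hv hr hvr with ⟨-, h1⟩ | ⟨h1, -⟩
      exacts [h1, (hxx (hvx.symm.trans h1)).elim]
    · refine (Set.ncard_le_ncard (t := {y₄, y₅}) ?_).trans ((Set.ncard_insert_le _ _).trans (by simp))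
      rintro r ⟨hr, hvr⟩
      rcases hx.eq_of_adj h hv hr hvr with ⟨h1, -⟩ | ⟨-, h1⟩
      exacts [(hvx h1).elim, h1]

end IsHexagonConfig

end Hexagons

section PathConfigs

variable {V : Type*} [Fintype V] [DecidableEq V] {H : SimpleGraph V} {K : Finset V}

/-- Three paths from the clique to a triangle covering all vertices outside the clique. -/
structure IsTriangleConfig (H : SimpleGraph V) (K : Finset V) (a b c : Fin 3 → V) : Prop where
  inj_a : Function.Injective a
  inj_b : Function.Injective b
  inj_c : Function.Injective c
  ne : ∀ i j, b i ≠ c j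
  mem_a : ∀ i, a i ∈ K
  notMem_b : ∀ i, b i ∉ K
  notMem_c : ∀ i, c i ∉ K
  cover : ∀ r ∉ K, ∃ i, r = b i ∨ r = c i
  adj_ac : ∀ i, H.Adj (a i) (c i)
  adj_cb : ∀ i, H.Adj (c i) (b i)
  adj_bb : ∀ i j, i ≠ j → H.Adj (b i) (b j)

theorem injective_vec_three {α : Type*} {x y z : α} (hxy : x ≠ y) (hxz : x ≠ z) (hyz : y ≠ z) :
    Function.Injective ![x, y, z] := by
  intro i j hij
  fin_cases i <;> fin_cases j <;> simp_all [eq_comm]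

theorem Fin.exists_ne_ne : ∀ i j : Fin 3, i ≠ j → ∃ k, i ≠ k ∧ j ≠ k := by
  decide

theorem IsMaxSystem.isTriangleConfig {Ls Rest : List (List V)} (hmax : IsMaxSystem H K Ls)
    (h : IsCliqueCore H K) {a₁ c₁ b₁ b₂ b₃ c₃ a₃ u w : V}
    (hp : Ls.Perm ((a₁ :: (([c₁, b₁] ++ b₂ :: [b₃, c₃]) ++ [a₃])) :: Rest))
    (hu : u ∈ K) (huL : u ∉ Ls.flatten) (hw : w ∉ K) (hwL : w ∉ Ls.flatten) (hwu : H.Adj w u)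
    (hwb : H.Adj w b₂) : IsTriangleConfig H K ![a₁, u, a₃] ![b₁, b₂, b₃] ![c₁, w, c₃] := by
  have hseg := hmax.isSegment hp
  have hchain := hseg.chain
  have hint := hseg.interior
  have hmem := hp.mem_iff.2 List.mem_cons_self
  have hnd : (a₁ :: (([c₁, b₁] ++ b₂ :: [b₃, c₃]) ++ [a₃])).Nodup :=
    (List.nodup_flatten.1 hmax.nodup).1 _ hmem
  have hb : H.Adj b₁ b₃ := by
    simpa using hmax.adj_of_attached h.claw hp hw hwL hwb
  have hwl : w ∉ (a₁ :: (([c₁, b₁] ++ b₂ :: [b₃, c₃]) ++ [a₃])) := fun h' =>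
    hwL (List.mem_flatten.2 ⟨_, hmem, h'⟩)
  have hul : u ∉ (a₁ :: (([c₁, b₁] ++ b₂ :: [b₃, c₃]) ++ [a₃])) := fun h' =>
    huL (List.mem_flatten.2 ⟨_, hmem, h'⟩)
  have hR : ([w, c₁, b₁, b₂, b₃, c₃] : List V).Nodup := by
    refine (List.nodup_cons.2 ⟨hwl, hnd⟩).sublist ?_
    refine List.Sublist.cons_cons _ (List.Sublist.cons _ ?_)
    exact List.sublist_append_left [c₁, b₁, b₂, b₃, c₃] [a₃]
  have hcov : ∀ r ∉ K, r ∈ [w, c₁, b₁, b₂, b₃, c₃] := fun r hr => by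
    refine h.mem_of_length hR ?_ (by simp) hr
    intro v hv
    rcases List.mem_cons.1 hv with rfl | hv
    exacts [hw, hint v hv]
  have hl := hseg.left
  have hr := hseg.right
  simp only [List.nil_append, List.cons_append, List.isChain_cons_cons] at hchain
  obtain ⟨e1, e2, e3, e4, e5, e6, -⟩ := hchain
  simp only [List.nil_append, List.cons_append, List.nodup_cons, List.mem_cons, List.not_mem_nil,
    or_false, not_or, forall_eq_or_imp, forall_eq] at hnd hwl hul hint
  obtain ⟨n1, n2, n3, n4, -⟩ := hnd
  have hbb : ∀ i j : Fin 3, i ≠ j → H.Adj (![b₁, b₂, b₃] i) (![b₁, b₂, b₃] j) := by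
    simp [Fin.forall_fin_succ, e3, e3.symm, e4, e4.symm, hb, hb.symm]
  refine ⟨?_, ?_, ?_, ?_, ?_, ?_, ?_, ?_, ?_, ?_, hbb⟩
  · exact injective_vec_three (Ne.symm hul.1) n1.2.2.2.2.2 hul.2.2.2.2.2.2
  · exact injective_vec_three n3.1 n3.2.1 n4.1
  · exact injective_vec_three (Ne.symm hwl.2.1) n2.2.2.2.1 hwl.2.2.2.2.2.1
  · have f1 := Ne.symm hwl.2.2.1
    have f2 := Ne.symm hwl.2.2.2.1
    have f3 := Ne.symm hwl.2.2.2.2.1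
    simp only [Fin.forall_fin_succ]
    simp [f1, f2, f3, n3, n4, Ne.symm n2.1, Ne.symm n2.2.1, Ne.symm n2.2.2.1]
    exact e5.ne
  · simp [Fin.forall_fin_succ, hu, hl, hr]
  · simp [Fin.forall_fin_succ, hint]
  · simp [Fin.forall_fin_succ, hint, hw]
  · intro r hr
    have := hcov r hr
    simp only [List.mem_cons, List.not_mem_nil, or_false] at this
    simp only [Fin.exists_fin_succ]
    simp
    tauto
  · simp [Fin.forall_fin_succ, e1, hwu.symm, e6.symm]
  · simp [Fin.forall_fin_succ, e2, hwb, e5.symm]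

namespace IsTriangleConfig

variable {a b c : Fin 3 → V} (hx : IsTriangleConfig H K a b c) (h : IsCliqueCore H K)
include hx

omit [Fintype V] [DecidableEq V] in
theorem ne_ab (i j : Fin 3) : a i ≠ b j := fun hij => hx.notMem_b j (hij ▸ hx.mem_a i)

omit [Fintype V] [DecidableEq V] in
theorem ne_ac (i j : Fin 3) : a i ≠ c j := fun hij => hx.notMem_c j (hij ▸ hx.mem_a i)

include h

theorem false_of_covering {i j k : Fin 3} (hij : i ≠ j) (hik : i ≠ k) (hjk : j ≠ k)
    {Ps : List (List V)} (hPs : ∀ P ∈ Ps, IsEndedChain H K P) (hnd : Ps.flatten.Nodup)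
    (hsub : [b i, b j, b k, c i, c j, c k] ⊆ Ps.flatten) : False := by
  refine h.false_of_cover hPs hnd fun r hr => hsub ?_
  obtain ⟨l, hl⟩ := hx.cover r hr
  have : l = i ∨ l = j ∨ l = k := by omega
  rcases this with rfl | rfl | rfl <;> simp <;> tauto

theorem not_adj_cc {i j : Fin 3} (hij : i ≠ j) : ¬ H.Adj (c i) (c j) := by
  intro hadj
  obtain ⟨k, hik, hjk⟩ : ∃ k, i ≠ k ∧ j ≠ k := Fin.exists_ne_ne i j hij
  refine hx.false_of_covering h hij hik hjk
    (Ps := [[a i, c i, c j, b j, b i, b k, c k, a k]]) ?_ ?_ ?_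
  · simp only [List.mem_singleton, forall_eq]
    refine ⟨by simp, ?_, by simpa using hx.mem_a i, by simpa using hx.mem_a k⟩
    simp [hx.adj_ac, hadj, hx.adj_cb, hx.adj_bb _ _ hij.symm, hx.adj_bb _ _ hik,
      (hx.adj_cb k).symm, (hx.adj_ac k).symm]
  · simp [hx.inj_a.eq_iff, hx.inj_b.eq_iff, hx.inj_c.eq_iff, hij, hik, hjk, hij.symm, hik.symm,
      hjk.symm, hx.ne_ab, hx.ne_ac, hx.ne, (hx.ne_ab _ _).symm, (hx.ne_ac _ _).symm,
      (hx.ne _ _).symm]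
  · intro r; simp; tauto

theorem not_adj_cb {i j : Fin 3} (hij : i ≠ j) : ¬ H.Adj (c i) (b j) := by
  intro hadj
  obtain ⟨k, hik, hjk⟩ : ∃ k, i ≠ k ∧ j ≠ k := Fin.exists_ne_ne i j hij
  refine hx.false_of_covering h hij hik hjk
    (Ps := [[a j, c j, b j, c i, b i, b k, c k, a k]]) ?_ ?_ ?_
  · simp only [List.mem_singleton, forall_eq]
    refine ⟨by simp, ?_, by simpa using hx.mem_a j, by simpa using hx.mem_a k⟩
    simp [hx.adj_ac, hadj.symm, hx.adj_cb, hx.adj_bb _ _ hik,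
      (hx.adj_cb k).symm, (hx.adj_ac k).symm]
  · simp [hx.inj_a.eq_iff, hx.inj_b.eq_iff, hx.inj_c.eq_iff, hij, hik, hjk, hij.symm, hik.symm,
      hjk.symm, hx.ne_ab, hx.ne_ac, hx.ne, (hx.ne_ab _ _).symm, (hx.ne_ac _ _).symm,
      (hx.ne _ _).symm]
  · intro r; simp; tauto

theorem eq_of_adj_c {i : Fin 3} {v : V} (hv : v ∈ K) (hadj : H.Adj (c i) v) : v = a i :=
  h.uniq _ (hx.notMem_c i) _ hv _ (hx.mem_a i) hadj (hx.adj_ac i).symm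

theorem eq_of_adj_b {j : Fin 3} {v : V} (hv : v ∈ K) (hadj : H.Adj (b j) v) : v = a j := by
  by_contra hvj
  obtain ⟨i, k, hij, hik, hjk⟩ : ∃ i k : Fin 3, i ≠ j ∧ i ≠ k ∧ j ≠ k := by
    obtain ⟨i, hi⟩ := exists_ne j
    obtain ⟨k, hk⟩ := Fin.exists_ne_ne i j hi
    exact ⟨i, k, hi, hk⟩
  have hva : ∀ l, v ≠ a l := by
    rintro l rfl
    have hlj : l ≠ j := by rintro rfl; exact hvj rfl
    exact hx.not_adj_cb h hlj (h.adj_of_common hv (hx.notMem_c l) (hx.notMem_b j)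
      (hx.ne j l).symm (hx.adj_ac l) hadj.symm)
  have hvb : ∀ l, v ≠ b l := by rintro l rfl; exact hx.notMem_b l hv
  have hvc : ∀ l, v ≠ c l := by rintro l rfl; exact hx.notMem_c l hv
  refine hx.false_of_covering h hij hik hjk
    (Ps := [[v, b j, c j, a j], [a i, c i, b i, b k, c k, a k]]) ?_ ?_ ?_
  · simp only [List.mem_cons, List.not_mem_nil, or_false, forall_eq_or_imp, forall_eq]
    refine ⟨⟨by simp, ?_, by simpa using hv, by simpa using hx.mem_a j⟩,
      ⟨by simp, ?_, by simpa using hx.mem_a i, by simpa using hx.mem_a k⟩⟩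
    · simp [hadj.symm, (hx.adj_cb j).symm, (hx.adj_ac j).symm]
    · simp [hx.adj_ac, hx.adj_cb, hx.adj_bb _ _ hik, (hx.adj_cb k).symm, (hx.adj_ac k).symm]
  · simp [hx.inj_a.eq_iff, hx.inj_b.eq_iff, hx.inj_c.eq_iff, hij, hik, hjk, hij.symm, hik.symm,
      hjk.symm, hx.ne_ab, hx.ne_ac, hx.ne, (hx.ne_ab _ _).symm, (hx.ne_ac _ _).symm,
      (hx.ne _ _).symm, hva, hvb, hvc]
  · intro r; simp; tauto

end IsTriangleConfig

end PathConfigs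

section TriangleIso

variable {V : Type*} [Fintype V] [DecidableEq V] {H : SimpleGraph V} {K : Finset V}

namespace IsTriangleConfig

variable {a b c : Fin 3 → V} (hx : IsTriangleConfig H K a b c)
include hx

theorem exists_equiv {n : ℕ} (hn : Fintype.card V = n) : ∃ e : V ≃ Fin n,
    (∀ v ∈ K, (e v).val < n - 6) ∧ (∀ i, (e (a i)).val = i) ∧ (∀ i, (e (b i)).val = n - 6 + i) ∧
    ∀ i, (e (c i)).val = n - 3 + i := by
  let rest := K.toList.filter (· ∉ List.ofFn a)
  let inner := List.ofFn a ++ rest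
  let l := inner ++ (List.ofFn b ++ List.ofFn c)
  have hinner : inner.Nodup := by
    refine List.nodup_append.2 ⟨List.nodup_ofFn.2 hx.inj_a, K.nodup_toList.filter _, ?_⟩
    rintro x hx y hy rfl
    have := (List.mem_filter.1 hy).2
    simp only [decide_eq_true_eq] at this
    exact this hx
  have hK : ∀ v, v ∈ inner ↔ v ∈ K := by
    intro v
    rw [List.mem_append, List.mem_filter, Finset.mem_toList, decide_eq_true_eq]
    constructor
    · rintro (hv | hv)
      · obtain ⟨i, rfl⟩ := List.mem_ofFn.1 hv
        exact hx.mem_a i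
      · exact hv.1
    · tauto
  have hl : l.Nodup := by
    refine List.nodup_append.2 ⟨hinner, List.nodup_append.2 ⟨List.nodup_ofFn.2 hx.inj_b,
      List.nodup_ofFn.2 hx.inj_c, ?_⟩, ?_⟩
    · rintro x hx' y hy rfl
      obtain ⟨i, rfl⟩ := List.mem_ofFn.1 hx'
      obtain ⟨j, hj⟩ := List.mem_ofFn.1 hy
      exact hx.ne i j hj.symm
    · rintro x hx' y hy rfl
      rw [hK] at hx'
      rcases List.mem_append.1 hy with hy | hy <;> obtain ⟨i, rfl⟩ := List.mem_ofFn.1 hy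
      exacts [hx.notMem_b i hx', hx.notMem_c i hx']
  have hmem : ∀ v, v ∈ l := by
    intro v
    rw [List.mem_append, hK, List.mem_append, List.mem_ofFn, List.mem_ofFn]
    by_cases hv : v ∈ K
    · exact Or.inl hv
    · obtain ⟨i, rfl | rfl⟩ := hx.cover v hv
      · exact Or.inr (Or.inl ⟨i, rfl⟩)
      · exact Or.inr (Or.inr ⟨i, rfl⟩)
  have hlen : l.length = n := by
    rw [← hn, ← List.toFinset_card_of_nodup hl, ← Finset.card_univ]
    congr 1
    exact Finset.eq_univ_iff_forall.2 fun v => List.mem_toFinset.2 (hmem v)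
  have hlen' : l.length = inner.length + 6 := by simp [l]
  have hlen₃ : inner.length = 3 + rest.length := by
    rw [List.length_append, List.length_ofFn]
  let e : V ≃ Fin n := (hl.getEquivOfForallMemList l hmem).symm.trans (finCongr hlen)
  have he : ∀ (m : ℕ) (hm : m < l.length), (e l[m]).val = m := by
    intro m hm
    have : (hl.getEquivOfForallMemList l hmem).symm l[m] = ⟨m, hm⟩ := by
      rw [Equiv.symm_apply_eq]
      rfl
    simp [e, this]
  refine ⟨e, fun v hv => ?_, fun i => ?_, fun i => ?_, fun i => ?_⟩
  · obtain ⟨m, hm, rfl⟩ := List.mem_iff_getElem.1 ((hK v).2 hv)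
    have h1 : inner[m] = l[m]'(by omega) := (List.getElem_append_left hm).symm
    rw [h1, he]
    omega
  · have h1 : a i = l[i.val]'(by omega) := by
      rw [List.getElem_append_left (by omega), List.getElem_append_left (by simp)]
      exact (List.getElem_ofFn _).symm
    rw [h1, he]
  · have h1 : b i = l[n - 6 + i.val]'(by omega) := by
      rw [List.getElem_append_right (by omega), List.getElem_append_left (by simp; omega)]
      simp only [List.getElem_ofFn]
      congr
      ext
      simp
      omega
    rw [h1, he]
  · have h1 : c i = l[n - 3 + i.val]'(by omega) := by
      rw [List.getElem_append_right (by omega), List.getElem_append_right (by simp; omega)]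
      simp only [List.getElem_ofFn]
      congr
      ext
      simp
      omega
    rw [h1, he]

/-- The graph of a triangle configuration is a subgraph of `EPgraph`. -/
theorem exists_le_comap (h : IsCliqueCore H K) {n : ℕ} (hn : Fintype.card V = n) :
    ∃ e : V ≃ Fin n, H ≤ (EPgraph n).comap e := by
  obtain ⟨e, heK, hea, heb, hec⟩ := hx.exists_equiv hn
  have hn' := heK _ (hx.mem_a 2)
  rw [hea] at hn'
  change 2 < n - 6 at hn'
  refine ⟨e, ?_⟩
  have hcross : ∀ u ∈ K, ∀ v ∉ K, H.Adj u v → (EPgraph n).Adj (e u) (e v) := by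
    intro u hu v hv huv
    obtain ⟨i, rfl | rfl⟩ := hx.cover v hv
    · obtain rfl := hx.eq_of_adj_b h hu huv.symm
      refine (fromRel_adj _ _ _).2 ⟨e.injective.ne huv.ne, Or.inl ?_⟩
      rw [hea, heb]
      omega
    · obtain rfl := hx.eq_of_adj_c h hu huv.symm
      refine (fromRel_adj _ _ _).2 ⟨e.injective.ne huv.ne, Or.inl ?_⟩
      rw [hea, hec]
      omega
  intro u v huv
  rw [comap_adj]
  by_cases hu : u ∈ K <;> by_cases hv : v ∈ K
  · exact (fromRel_adj _ _ _).2 ⟨e.injective.ne huv.ne, Or.inl (Or.inl ⟨heK u hu, heK v hv⟩)⟩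
  · exact hcross u hu v hv huv
  · exact (hcross v hv u hu huv.symm).symm
  · refine (fromRel_adj _ _ _).2 ⟨e.injective.ne huv.ne, ?_⟩
    obtain ⟨i, rfl | rfl⟩ := hx.cover u hu <;> obtain ⟨j, rfl | rfl⟩ := hx.cover v hv
    · rw [heb, heb]
      omega
    · have hij : i = j := by
        by_contra hij
        exact hx.not_adj_cb h (Ne.symm hij) huv.symm
      rw [heb, hec, hij]
      omega
    · have hij : i = j := by
        by_contra hij
        exact hx.not_adj_cb h hij huv
      rw [heb, hec, hij]
      omega
    · exfalso
      refine hx.not_adj_cc h (fun hij => huv.ne ?_) huv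
      rw [hij]

end IsTriangleConfig

end TriangleIso

section TwoConnectedGraphs

variable {V : Type*} [Fintype V] [DecidableEq V] {G H : SimpleGraph V}

theorem TwoConnected.mono (h : TwoConnected G) (hGH : G ≤ H) : TwoConnected H :=
  ⟨h.1, fun v => (h.2 v).mono (comap_monotone _ hGH)⟩

theorem TwoConnected.connected (h : TwoConnected G) : G.Connected := by
  have h3 := h.1
  have : Nonempty V := Fintype.card_pos_iff.1 (by omega)
  refine ⟨fun u v => ?_⟩
  obtain ⟨w, hw⟩ : ∃ w, w ∉ ({u, v} : Finset V) := by
    by_contra! hall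
    have h1 := Finset.card_le_card (fun w _ => hall w : (Finset.univ : Finset V) ⊆ {u, v})
    have h2 := Finset.card_le_two (a := u) (b := v)
    rw [Finset.card_univ] at h1
    omega
  simp only [Finset.mem_insert, Finset.mem_singleton, not_or] at hw
  have := (h.2 w).preconnected ⟨u, fun h' => hw.1 h'.symm⟩ ⟨v, fun h' => hw.2 h'.symm⟩
  exact this.map (Embedding.induce _).toHom

end TwoConnectedGraphs

theorem statement_2 {V : Type*} [Fintype V] [DecidableEq V] (G : SimpleGraph V) (n : ℕ)
    (hn : 51 ≤ n) (hcard : Fintype.card V = n)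
    (h2conn : TwoConnected G) (hclaw : ClawFree G)
    (hq : qIndex G ≥ qIndex (EPgraph n)) :
    G.IsHamiltonian ∨ Nonempty (G ≃g EPgraph n) := by
  by_cases hham : G.IsHamiltonian
  · exact Or.inl hham
  right
  have h3 : 3 ≤ Fintype.card V := by omega
  have : Nonempty V := Fintype.card_pos_iff.1 (by omega)
  have : Nontrivial V := Fintype.one_lt_card_iff_nontrivial.1 (by omega)
  obtain ⟨H, hGH, hHclaw, hHham, hdia⟩ := hclaw.exists_diamondFree_ge h3 hham
  have hH := h2conn.mono hGH
  have hqH : qIndex (EPgraph n) ≤ qIndex H := hq.le.trans (qIndex_mono hGH)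
  obtain ⟨k, rfl⟩ : ∃ k, n = k + 6 := ⟨n - 6, by omega⟩
  have hEP := mul_add_six_le_qIndex_EPgraph k (by omega)
  have hk : (45 : ℝ) ≤ k := by exact_mod_cast (by omega : 45 ≤ k)
  have hlow : (2 * (((k + 6 : ℕ) : ℝ) - 7) : ℝ) ≤ qIndex H := by
    push_cast
    nlinarith
  obtain ⟨K, hK, hsmall, huniq⟩ := exists_large_clique hHclaw hdia hn hcard
    (fun v => hH.connected.preconnected.exists_adj_of_nontrivial v) hlow
  have hcore : IsCliqueCore H K := by
    refine ⟨hHclaw, hK, huniq, ?_, h3, hsmall, hHham⟩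
    have := K.card_add_card_compl
    omega
  obtain ⟨Ls, hmax⟩ := hcore.exists_isMaxSystem
  rcases hmax.exists_exceptional hcore hH with
    ⟨Rest, a, c₁, b₁, b₂, b₃, c₃, a₃, u, w, hp, hu, huL, hw, hwL, hwu, hwb⟩ |
    ⟨Rest, a, y₁, y₂, y₃, y₄, y₅, a', w, hp, hw, hwL, hw₁, hw₅⟩
  · have hx := hmax.isTriangleConfig hcore hp hu huL hw hwL hwu hwb
    obtain ⟨e, he⟩ := hx.exists_le_comap hcore hcard
    let iso : (EPgraph (k + 6)).comap e ≃g EPgraph (k + 6) := Iso.comap e _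
    have hGE : G ≤ (EPgraph (k + 6)).comap e := hGH.trans he
    have heq := eq_of_le_of_qIndex_le hGE (h2conn.connected.mono hGE)
      ((qIndex_le_of_iso iso).trans hq)
    exact ⟨heq ▸ iso⟩
  · exfalso
    have hx := hmax.isHexagonConfig hcore hp hw hwL hw₁ hw₅
    obtain ⟨hKc, hle⟩ := hx.qIndex_mul_le hcore (by omega)
    obtain rfl : K.card = k := by omega
    have := mul_le_mul_of_nonneg_right hqH (Nat.cast_nonneg (α := ℝ) K.card)
    linarith
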